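/- The logic IPC ⊕ {𝒥(Q_i) : i ∈ {2,4,5,6,7,8}} is locally tabular, its finite rooted frames are exactly the broken combs, and it coincides with the logic LFC = Log({P : P is an n-comb for some n}). -/

import Mathlib

/-! # Common framework: superintuitionistic logics, Kripke frames and models -/

/-! ## Intuitionistic propositional formulas -/

inductive Form : Type
  | var : ℕ → Form
  | bot : Form
  | top : Form
  | and : Form → Form → Form
  | or  : Form → Form → Form
  | imp : Form → Form → Form
deriving DecidableEq

namespace Form

/-- Implication depth of a formula. -/
def depth : Form → ℕ
  | var _ => 0
  | bot => 0
  | top => 0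
  | and φ ψ => max φ.depth ψ.depth
  | or φ ψ => max φ.depth ψ.depth
  | imp φ ψ => max φ.depth ψ.depth + 1

/-- All propositional variables of the formula are among `p_0, …, p_{m-1}`. -/
def varsLt (m : ℕ) : Form → Prop
  | var p => p < m
  | bot => True
  | top => True
  | and φ ψ => φ.varsLt m ∧ ψ.varsLt m
  | or φ ψ => φ.varsLt m ∧ ψ.varsLt m
  | imp φ ψ => φ.varsLt m ∧ ψ.varsLt m

/-- Uniform substitution. -/
def subst (σ : ℕ → Form) : Form → Form
  | var p => σ p
  | bot => bot
  | top => top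
  | and φ ψ => and (φ.subst σ) (ψ.subst σ)
  | or φ ψ => or (φ.subst σ) (ψ.subst σ)
  | imp φ ψ => imp (φ.subst σ) (ψ.subst σ)

/-- Biconditional. -/
def iff (φ ψ : Form) : Form := and (imp φ ψ) (imp ψ φ)

/-- Negation. -/
def neg (φ : Form) : Form := imp φ bot

end Form

/-! ## IPC and superintuitionistic logics -/

/-- A Hilbert-style axiomatization of intuitionistic propositional logic. -/
inductive IPC : Form → Prop
  | ax1 (φ ψ : Form) : IPC (.imp φ (.imp ψ φ))
  | ax2 (φ ψ χ : Form) :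
      IPC (.imp (.imp φ (.imp ψ χ)) (.imp (.imp φ ψ) (.imp φ χ)))
  | andE1 (φ ψ : Form) : IPC (.imp (.and φ ψ) φ)
  | andE2 (φ ψ : Form) : IPC (.imp (.and φ ψ) ψ)
  | andI (φ ψ : Form) : IPC (.imp φ (.imp ψ (.and φ ψ)))
  | orI1 (φ ψ : Form) : IPC (.imp φ (.or φ ψ))
  | orI2 (φ ψ : Form) : IPC (.imp ψ (.or φ ψ))
  | orE (φ ψ χ : Form) :
      IPC (.imp (.imp φ χ) (.imp (.imp ψ χ) (.imp (.or φ ψ) χ)))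
  | botE (φ : Form) : IPC (.imp .bot φ)
  | topI : IPC .top
  | mp (φ ψ : Form) : IPC (.imp φ ψ) → IPC φ → IPC ψ

/-- The set of theorems of IPC. -/
def IPCSet : Set Form := {φ | IPC φ}

/-- A superintuitionistic logic: a set of formulas containing all theorems of
IPC, closed under modus ponens and uniform substitution. -/
def IsSILogic (L : Set Form) : Prop :=
  IPCSet ⊆ L ∧
  (∀ φ ψ : Form, Form.imp φ ψ ∈ L → φ ∈ L → ψ ∈ L) ∧
  (∀ (φ : Form) (σ : ℕ → Form), φ ∈ L → φ.subst σ ∈ L)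

/-- `oplus L Γ` is the least superintuitionistic logic containing `L` and `Γ`
(written `L ⊕ Γ`). -/
def oplus (L Γ : Set Form) : Set Form :=
  ⋂₀ {M : Set Form | IsSILogic M ∧ L ⊆ M ∧ Γ ⊆ M}

/-- A logic is `n`-uniform if every formula is provably equivalent in it to a
formula of implication depth at most `n`. -/
def Uniform (L : Set Form) (n : ℕ) : Prop :=
  ∀ φ : Form, ∃ ψ : Form, ψ.depth ≤ n ∧ Form.iff φ ψ ∈ L

/-- A logic is locally tabular if over each finite tuple of variables there are
only finitely many formulas up to provable equivalence. -/
def LocallyTabular (L : Set Form) : Prop :=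
  ∀ m : ℕ, ∃ Φ : Finset Form, ∀ φ : Form, φ.varsLt m → ∃ ψ ∈ Φ, Form.iff φ ψ ∈ L

/-! ## Kripke frames (posets) -/

structure Frame : Type 1 where
  W : Type
  le : W → W → Prop
  refl : ∀ x, le x x
  trans : ∀ x y z, le x y → le y z → le x z
  antisymm : ∀ x y, le x y → le y x → x = y

namespace Frame

def lt (F : Frame) (a b : F.W) : Prop := F.le a b ∧ a ≠ b

/-- A valuation is persistent if it is preserved upwards. -/
def Persistent (F : Frame) (V : ℕ → F.W → Prop) : Prop :=
  ∀ p a b, F.le a b → V p a → V p b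

/-- Kripke forcing. -/
def force (F : Frame) (V : ℕ → F.W → Prop) : Form → F.W → Prop
  | .var p, w => V p w
  | .bot, _ => False
  | .top, _ => True
  | .and φ ψ, w => F.force V φ w ∧ F.force V ψ w
  | .or φ ψ, w => F.force V φ w ∨ F.force V ψ w
  | .imp φ ψ, w => ∀ v, F.le w v → F.force V φ v → F.force V ψ v

/-- `F ⊩ φ`. -/
def Valid (F : Frame) (φ : Form) : Prop :=
  ∀ V : ℕ → F.W → Prop, F.Persistent V → ∀ w : F.W, F.force V φ w

def Rooted (F : Frame) : Prop := ∃ r, ∀ w, F.le r w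

/-- The subposet on a subset of the carrier. -/
def restrict (F : Frame) (s : Set F.W) : Frame where
  W := s
  le a b := F.le a.1 b.1
  refl a := F.refl a.1
  trans a b c h1 h2 := F.trans a.1 b.1 c.1 h1 h2
  antisymm a b h1 h2 := Subtype.ext (F.antisymm a.1 b.1 h1 h2)

/-- The rooted upset `↑z`. -/
def up (F : Frame) (z : F.W) : Frame := F.restrict {w | F.le z w}

/-- There is a chain of `d` elements in `↑w` starting at `w`. -/
def hasChainUp (F : Frame) (w : F.W) (d : ℕ) : Prop :=
  ∃ f : Fin d → F.W, (∀ i : Fin d, (i : ℕ) = 0 → f i = w) ∧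
    (∀ i j : Fin d, (i : ℕ) < (j : ℕ) → F.lt (f i) (f j))

/-- The depth of `w` is `d`: the longest chain in `↑w` has exactly `d` elements. -/
def depthEq (F : Frame) (w : F.W) (d : ℕ) : Prop :=
  F.hasChainUp w d ∧ ¬ F.hasChainUp w (d + 1)

/-- The covering relation of the poset. -/
def covBy (F : Frame) (a b : F.W) : Prop :=
  F.lt a b ∧ ∀ c, F.lt a c → F.lt c b → False

end Frame

/-- A p-morphism of posets. -/
def IsPMorphism (P Q : Frame) (f : P.W → Q.W) : Prop :=
  (∀ a b, P.le a b → Q.le (f a) (f b)) ∧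
  (∀ a b, Q.le (f a) b → ∃ a', P.le a a' ∧ f a' = b)

/-- `Q` is a p-morphic image of `P`. -/
def PMorphicImage (P Q : Frame) : Prop :=
  ∃ f : P.W → Q.W, IsPMorphism P Q f ∧ Function.Surjective f

/-- Order isomorphism of posets. -/
def FrameIso (P Q : Frame) : Prop :=
  ∃ f : P.W → Q.W, Function.Bijective f ∧ ∀ a b, P.le a b ↔ Q.le (f a) (f b)

/-- The logic of a class of posets. -/
def LogK (K : Set Frame) : Set Form := {φ | ∀ F ∈ K, F.Valid φ}

/-- The logic of a single poset. -/
def FrameLog (F : Frame) : Set Form := {φ | F.Valid φ}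

/-- `J` is a Yankov formula for the finite rooted poset `Q`: a finite poset
refutes `J` exactly when `Q` is isomorphic to a rooted upset of one of its
p-morphic images. -/
def IsYankov (J : Form) (Q : Frame) : Prop :=
  ∀ P : Frame, Finite P.W →
    (¬ P.Valid J ↔ ∃ G : Frame, PMorphicImage P G ∧ ∃ z : G.W, FrameIso (G.up z) Q)

/-! ## Rooted Kripke models over `n` propositional variables -/

structure Model (n : ℕ) : Type 1 where
  W : Type
  le : W → W → Prop
  refl : ∀ x, le x x
  trans : ∀ x y z, le x y → le y z → le x z
  antisymm : ∀ x y, le x y → le y x → x = y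
  root : W
  rooted : ∀ w, le root w
  col : W → Set (Fin n)
  mono : ∀ a b, le a b → col a ⊆ col b

namespace Model

/-- The underlying poset of a model. -/
def frame {n : ℕ} (M : Model n) : Frame :=
  ⟨M.W, M.le, M.refl, M.trans, M.antisymm⟩

def force {n : ℕ} (M : Model n) : Form → M.W → Prop
  | .var p, w => ∃ h : p < n, (⟨p, h⟩ : Fin n) ∈ M.col w
  | .bot, _ => False
  | .top, _ => True
  | .and φ ψ, w => M.force φ w ∧ M.force ψ w
  | .or φ ψ, w => M.force φ w ∨ M.force ψ w
  | .imp φ ψ, w => ∀ v, M.le w v → M.force φ v → M.force ψ v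

/-- Satisfaction at the root of the model. -/
def Sat {n : ℕ} (M : Model n) (φ : Form) : Prop := M.force φ M.root

/-- (Full) bisimilarity of two rooted models. -/
def Bisim {n : ℕ} (M N : Model n) : Prop :=
  ∃ S : M.W → N.W → Prop,
    S M.root N.root ∧
    (∀ a b, S a b → M.col a = N.col b) ∧
    (∀ a b a', S a b → M.le a a' → ∃ b', N.le b b' ∧ S a' b') ∧
    (∀ a b b', S a b → N.le b b' → ∃ a', M.le a a' ∧ S a' b')

/-- `k`-bisimilarity of the points `x, y`, via a decreasing chain
`S k ⊆ ⋯ ⊆ S 0` of relations. -/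
def NBisimAt {n : ℕ} (M N : Model n) (k : ℕ) (x : M.W) (y : N.W) : Prop :=
  ∃ S : ℕ → M.W → N.W → Prop,
    (∀ j a b, S (j + 1) a b → S j a b) ∧
    S k x y ∧
    (∀ a b, S 0 a b → M.col a = N.col b) ∧
    (∀ j a b a', j < k → S (j + 1) a b → M.le a a' →
        ∃ b', N.le b b' ∧ S j a' b') ∧
    (∀ j a b b', j < k → S (j + 1) a b → N.le b b' →
        ∃ a', M.le a a' ∧ S j a' b')

/-- `k`-bisimilarity of two rooted models. -/
def NBisim {n : ℕ} (M N : Model n) (k : ℕ) : Prop :=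
  NBisimAt M N k M.root N.root

/-- The submodel on the rooted upset `↑z`. -/
def up {n : ℕ} (M : Model n) (z : M.W) : Model n where
  W := {w : M.W // M.le z w}
  le a b := M.le a.1 b.1
  refl a := M.refl a.1
  trans a b c h1 h2 := M.trans a.1 b.1 c.1 h1 h2
  antisymm a b h1 h2 := Subtype.ext (M.antisymm a.1 b.1 h1 h2)
  root := ⟨z, M.refl z⟩
  rooted w := w.2
  col a := M.col a.1
  mono a b h := M.mono a.1 b.1 h

/-- `(M, x) ≤ₖ (N, y)`: there is `z ≥ x` such that `(↑z, z)` is `k`-bisimilar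
with `(N, y)`. -/
def LeBisim {n : ℕ} (M N : Model n) (k : ℕ) : Prop :=
  ∃ z : M.W, M.le M.root z ∧ NBisim (M.up z) N k

/-- Two points of a model are bisimilar. -/
def PointsBisim {n : ℕ} (M : Model n) (a b : M.W) : Prop :=
  ∃ S : M.W → M.W → Prop,
    S a b ∧
    (∀ x y, S x y → M.col x = M.col y) ∧
    (∀ x y x', S x y → M.le x x' → ∃ y', M.le y y' ∧ S x' y') ∧
    (∀ x y y', S x y → M.le y y' → ∃ x', M.le x x' ∧ S x' y')

/-- A model over `n` variables is (`n`-)generated if it contains no two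
distinct bisimilar points. -/
def Generated {n : ℕ} (M : Model n) : Prop :=
  ∀ a b : M.W, M.PointsBisim a b → a = b

/-- Isomorphism of models: a root-preserving, color-preserving order
isomorphism. -/
def Iso {n : ℕ} (M N : Model n) : Prop :=
  ∃ f : M.W → N.W, Function.Bijective f ∧ f M.root = N.root ∧
    (∀ a b, M.le a b ↔ N.le (f a) (f b)) ∧ (∀ a, N.col (f a) = M.col a)

/-- `M` is a model over the class of posets `K`: its underlying poset is a
p-morphic image of a rooted upset of a member of `K`. -/
def InClass {n : ℕ} (K : Set Frame) (M : Model n) : Prop :=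
  ∃ F ∈ K, ∃ z : F.W, PMorphicImage (F.up z) M.frame

/-- The model on the rooted upset `↑z` of a frame `F`, with coloring `c`. -/
def ofFrame (F : Frame) (z : F.W) (n : ℕ) (c : (F.up z).W → Set (Fin n))
    (hc : ∀ a b : (F.up z).W, (F.up z).le a b → c a ⊆ c b) : Model n where
  W := (F.up z).W
  le := (F.up z).le
  refl := (F.up z).refl
  trans := (F.up z).trans
  antisymm := (F.up z).antisymm
  root := ⟨z, F.refl z⟩
  rooted w := w.2
  col := c
  mono := hc

end Model

/-! ## Boolean sums and stacks -/

/-- A (finite rooted) poset is a Boolean sum: it is rooted, covers decrease the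
depth by exactly one, and every point of depth `k+1` lies below every point of
depth `k`. -/
def IsBooleanSum (F : Frame) : Prop :=
  F.Rooted ∧
  (∀ a b da db, F.covBy a b → F.depthEq a da → F.depthEq b db → da = db + 1) ∧
  (∀ a b k, F.depthEq a (k + 1) → F.depthEq b k → F.le a b)

/-- `F` contains a `k`-stack: `k` consecutive layers (sets of points of equal
depth) each containing at least two points. -/
def HasStack (F : Frame) (k : ℕ) : Prop :=
  ∃ j : ℕ, ∀ i : ℕ, j ≤ i → i < j + k →
    ∃ a b : F.W, a ≠ b ∧ F.depthEq a i ∧ F.depthEq b i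

/-! ## The posets Q₁, …, Q₈ -/

def q1le : Fin 4 → Fin 4 → Bool := fun a b =>
  a = b || a = 0 || (a = 1 && b = 3)
def q2le : Fin 5 → Fin 5 → Bool := fun a b =>
  a = b || a = 0 || (a = 1 && (b = 3 || b = 4)) || (a = 2 && b = 4)
def q3le : Fin 5 → Fin 5 → Bool := fun a b =>
  a = b || a = 0 || (a = 1 && b = 4) || (a = 2 && (b = 3 || b = 4)) ||
    (a = 3 && b = 4)
def q4le : Fin 5 → Fin 5 → Bool := fun a b =>
  a = b || a = 0 || ((a = 1 || a = 2) && (b = 3 || b = 4))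
def q5le : Fin 6 → Fin 6 → Bool := fun a b =>
  a = b || a = 0 || b = 5 || ((a = 1 || a = 2) && (b = 3 || b = 4))
def q6le : Fin 4 → Fin 4 → Bool := fun a b =>
  a = b || a = 0 || b = 3
def q7le : Fin 5 → Fin 5 → Bool := fun a b =>
  a = b || a = 0 || (a = 1 && b = 3) || (a = 2 && b = 4)
def q8le : Fin 4 → Fin 4 → Bool := fun a b =>
  a = b || a = 0

/-- `Q₁`: root `0`; immediate successors `1`, `2`; `2` maximal; `3` the unique
(maximal) immediate successor of `1`. -/
def Q1f : Frame :=
  ⟨Fin 4, fun a b => q1le a b = true, by decide, by decide, by decide⟩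
/-- `Q₂`: root `0`; immediate successors `1`, `2`; maximal points `3`, `4`;
`1 < 3`, `1 < 4`, `2 < 4`, `2 ≮ 3`. -/
def Q2f : Frame :=
  ⟨Fin 5, fun a b => q2le a b = true, by decide, by decide, by decide⟩
/-- `Q₃`: root `0`; immediate successors `1`, `2`; `3` covers `2`; top `4`
with `1 < 4` and `3 < 4`. -/
def Q3f : Frame :=
  ⟨Fin 5, fun a b => q3le a b = true, by decide, by decide, by decide⟩
/-- `Q₄`: root `0`; `1`, `2` cover the root; maximal `3`, `4` above both `1`
and `2`. -/
def Q4f : Frame :=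
  ⟨Fin 5, fun a b => q4le a b = true, by decide, by decide, by decide⟩
/-- `Q₅`: `Q₄` with a greatest element `5` added on top. -/
def Q5f : Frame :=
  ⟨Fin 6, fun a b => q5le a b = true, by decide, by decide, by decide⟩
/-- `Q₆`: the diamond. -/
def Q6f : Frame :=
  ⟨Fin 4, fun a b => q6le a b = true, by decide, by decide, by decide⟩
/-- `Q₇`: root `0`; `1 < 3`, `2 < 4`, and no other strict relations above the
root. -/
def Q7f : Frame :=
  ⟨Fin 5, fun a b => q7le a b = true, by decide, by decide, by decide⟩
/-- `Q₈`: a root with three pairwise incomparable maximal points. -/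
def Q8f : Frame :=
  ⟨Fin 4, fun a b => q8le a b = true, by decide, by decide, by decide⟩

/-! ## Particular logics -/

/-- The one-element poset. -/
def unitFrame : Frame :=
  ⟨PUnit, fun _ _ => True, fun _ => trivial, fun _ _ _ _ _ => trivial,
    fun a b _ _ => Subsingleton.elim a b⟩

/-- The two-element chain. -/
def chain2 : Frame :=
  ⟨Bool, fun a b => a ≤ b, le_refl, fun _ _ _ => le_trans,
    fun _ _ => le_antisymm⟩

/-- Classical propositional logic: the logic of the one-element poset. -/
def CPC : Set Form := FrameLog unitFrame

/-- The logic of the two-element chain. -/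
def Sme : Set Form := FrameLog chain2

/-- The weak Peirce law `(q → p) ∨ (((p → q) → p) → p)`. -/
def wPLax : Form :=
  .or (.imp (.var 1) (.var 0))
    (.imp (.imp (.imp (.var 0) (.var 1)) (.var 0)) (.var 0))

/-- The logic `wPL = IPC ⊕ (q → p) ∨ (((p → q) → p) → p)`. -/
def wPL : Set Form := oplus IPCSet {wPLax}

/-- The bounded-width-2 axiom `⋁_{i≤2} (pᵢ → ⋁_{j≠i} pⱼ)`. -/
def bw2ax : Form :=
  .or (.imp (.var 0) (.or (.var 1) (.var 2)))
    (.or (.imp (.var 1) (.or (.var 0) (.var 2)))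
      (.imp (.var 2) (.or (.var 0) (.var 1))))

/-- The axiom `¬p ∨ ¬¬p`. -/
def kcax : Form := .or (Form.neg (.var 0)) (Form.neg (Form.neg (.var 0)))

/-- The logic `Box = wPL ⊕ bw₂ ⊕ (¬p ∨ ¬¬p)`. -/
def BoxLogic : Set Form := oplus wPL {bw2ax, kcax}

/-- The bounded-depth formulas. -/
def bd : ℕ → Form
  | 0 => .var 0
  | n + 1 => .or (.var (n + 1)) (.imp (.var (n + 1)) (bd n))

/-- The logic `BD_n = IPC ⊕ bd_n`. -/
def BD (n : ℕ) : Set Form := oplus IPCSet {bd n}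

/-- A logic is of finite depth if it contains some `BD_n`. -/
def FiniteDepth (L : Set Form) : Prop := ∃ n, BD n ⊆ L

/-! ## The Rieger–Nishimura ladder -/

/-- Points of the Rieger–Nishimura ladder: `inl k = L_k`, `inr k = R_k`. -/
abbrev RNpt : Type := ℕ ⊕ ℕ

/-- The covering relation of the Rieger–Nishimura ladder (`rnCov a b` means
`a ⋖ b`, i.e. `b` is an immediate successor of `a`). -/
inductive rnCov : RNpt → RNpt → Prop
  | ll (k : ℕ) : rnCov (.inl (k + 1)) (.inl k)
  | rr (k : ℕ) : rnCov (.inr (k + 1)) (.inr k)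
  | rl (k : ℕ) : rnCov (.inr (k + 1)) (.inl k)
  | lr (k : ℕ) : rnCov (.inl (k + 2)) (.inr k)

private def rnIdx : RNpt → ℕ
  | .inl k => 2 * k
  | .inr k => 2 * k + 1

private theorem rnCov_idx {a b : RNpt} (h : rnCov a b) : rnIdx b < rnIdx a := by
  cases h <;> simp [rnIdx] <;> omega

private theorem rnLe_idx {a b : RNpt} (h : Relation.ReflTransGen rnCov a b) :
    rnIdx b ≤ rnIdx a := by
  induction h with
  | refl => exact le_rfl
  | tail _ h₂ ih => exact le_trans (le_of_lt (rnCov_idx h₂)) ih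

private theorem rnIdx_inj {a b : RNpt} (h : rnIdx a = rnIdx b) : a = b := by
  rcases a with a | a <;> rcases b with b | b <;> simp [rnIdx] at h ⊢ <;> omega

/-- The Rieger–Nishimura ladder as a poset: the order is the reflexive
transitive closure of the covering relation. -/
def RN : Frame where
  W := RNpt
  le a b := Relation.ReflTransGen rnCov a b
  refl _ := Relation.ReflTransGen.refl
  trans _ _ _ h1 h2 := h1.trans h2
  antisymm _ _ h1 h2 := rnIdx_inj (le_antisymm (rnLe_idx h2) (rnLe_idx h1))

/-! ## Combs -/

def combLe (n : ℕ) : (Fin n ⊕ Fin n) → (Fin n ⊕ Fin n) → Prop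
  | .inl i, .inl j => i ≤ j
  | .inl i, .inr j => i ≤ j
  | .inr i, .inr j => i = j
  | .inr _, .inl _ => False

/-- The `n`-comb: base points `x_1 ≤ … ≤ x_n` (encoded `inl 0, …, inl (n-1)`)
and maximal teeth `y_1, …, y_n` (encoded `inr 0, …, inr (n-1)`), with
`x_i ≤ y_j ↔ i ≤ j` and the teeth pairwise incomparable. -/
def Comb (n : ℕ) : Frame where
  W := Fin n ⊕ Fin n
  le := combLe n
  refl := by rintro (i | i) <;> simp [combLe]
  trans := by
    rintro (i | i) (j | j) (k | k) h1 h2 <;> simp only [combLe] at * <;>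
      first
        | exact le_trans h1 h2
        | exact h2 ▸ h1
  antisymm := by
    rintro (i | i) (j | j) h1 h2 <;> simp only [combLe] at * <;>
      first
        | exact congrArg Sum.inl (le_antisymm h1 h2)
        | exact congrArg Sum.inr h1

/-- A broken `m`-comb: (isomorphic to) a subposet of the `m`-comb containing
all of the base points `x_1, …, x_m`. -/
def IsBrokenComb (F : Frame) (m : ℕ) : Prop :=
  ∃ s : Set (Comb m).W, (∀ i : Fin m, Sum.inl i ∈ s) ∧
    FrameIso F ((Comb m).restrict s)

/-- The logic of the class of all combs. -/
def LFC : Set Form := LogK {F | ∃ n, F = Comb n}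

/-! ## The stacked models `M_n^k` and `N_n^k` -/

/-- Height index of a point: layer `j` (from the top) has index `j`, the root
(`none`) has index `k+1`. -/
def stackIdx (k : ℕ) : Option (Fin (k + 1) × Bool) → ℕ
  | none => k + 1
  | some (j, _) => j

/-- Size of the color (an initial segment of the variables): the left point
(`false`) of layer `j` gets `1^{n-j}0^j`, the right point (`true`) gets
`1^{n-j-1}0^{j+1}`, and the root gets `1^r0^{n-r}`. -/
def stackColSize (n k r : ℕ) : Option (Fin (k + 1) × Bool) → ℕ
  | none => r
  | some (j, false) => n - j
  | some (j, true) => n - ((j : ℕ) + 1)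

private theorem stackColSize_le (n k r : ℕ) (hr : r ≤ n - (k + 1))
    {a b : Option (Fin (k + 1) × Bool)} (h : stackIdx k b < stackIdx k a) :
    stackColSize n k r a ≤ stackColSize n k r b := by
  rcases a with _ | ⟨j, _ | _⟩ <;> rcases b with _ | ⟨j', _ | _⟩ <;>
    simp only [stackIdx, stackColSize] at * <;> omega

/-- The common shape of `M_n^k` and `N_n^k`, with root color `1^r0^{n-r}`:
`k+1` layers of two points stacked on top of a root. -/
def stackModel (n k r : ℕ) (hr : r ≤ n - (k + 1)) : Model n where
  W := Option (Fin (k + 1) × Bool)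
  le a b := a = b ∨ stackIdx k b < stackIdx k a
  refl _ := Or.inl rfl
  trans := by
    rintro a b c (rfl | h1) h2
    · exact h2
    · rcases h2 with rfl | h2
      · exact Or.inr h1
      · exact Or.inr (h2.trans h1)
  antisymm := by
    rintro a b (rfl | h1) h2
    · rfl
    · rcases h2 with rfl | h2
      · rfl
      · omega
  root := none
  rooted := by
    rintro (_ | ⟨j, s⟩)
    · exact Or.inl rfl
    · exact Or.inr j.isLt
  col a := {i : Fin n | (i : ℕ) < stackColSize n k r a}
  mono := by
    rintro a b (rfl | h) i hi
    · exact hi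
    · exact lt_of_lt_of_le hi (stackColSize_le n k r hr h)

/-- The model `M_n^k` (root color `1^{n-k-1}0^{k+1}`). -/
def Mmodel (n k : ℕ) : Model n := stackModel n k (n - (k + 1)) le_rfl

/-- The model `N_n^k` (root color `1^{n-k-2}0^{k+2}`). -/
def Nmodel (n k : ℕ) : Model n := stackModel n k (n - (k + 2)) (by omega)

/-! ## The frames `S_n` -/

/-- Height index in `S_n`: the top point (`some none`) has index `0`, the two
points of the `j`-th middle layer have index `j+1`, and the root (`none`) has
index `n`. -/
def sIdx (n : ℕ) : Option (Option (Fin (n - 1) × Bool)) → ℕ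
  | none => n
  | some none => 0
  | some (some (j, _)) => (j : ℕ) + 1

/-- The frame `S_n` (for `n ≥ 2`): the Boolean sum whose layers from top to
bottom have sizes `1, 2, …, 2, 1` (with `n - 1` layers of size `2`). -/
def SFrame (n : ℕ) : Frame where
  W := Option (Option (Fin (n - 1) × Bool))
  le a b := a = b ∨ sIdx n b < sIdx n a
  refl _ := Or.inl rfl
  trans := by
    rintro a b c (rfl | h1) h2
    · exact h2
    · rcases h2 with rfl | h2
      · exact Or.inr h1
      · exact Or.inr (h2.trans h1)
  antisymm := by
    rintro a b (rfl | h1) h2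
    · rfl
    · rcases h2 with rfl | h2
      · rfl
      · omega

/-! ## Helper lemmas -/

theorem s13_persist (F : Frame) (V : ℕ → F.W → Prop) (hV : F.Persistent V) (φ : Form) :
    ∀ a b, F.le a b → F.force V φ a → F.force V φ b := by
  induction φ with
  | var p => intro a b h; exact hV p a b h
  | bot => intro a b _ h; exact h
  | top => intro a b _ h; exact h
  | and φ ψ ih1 ih2 => intro a b h h'; exact ⟨ih1 a b h h'.1, ih2 a b h h'.2⟩
  | or φ ψ ih1 ih2 =>
    intro a b h h'
    exact h'.imp (ih1 a b h) (ih2 a b h)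
  | imp φ ψ ih1 ih2 => intro a b h h' v hv; exact h' v (F.trans _ _ _ h hv)

theorem s13_sound (F : Frame) (φ : Form) (h : IPC φ) : F.Valid φ := by
  intro V hV
  have P := s13_persist F V hV
  induction h with
  | ax1 φ ψ => intro w v _ h1 u hu _; exact P _ _ _ hu h1
  | ax2 φ ψ χ =>
    intro w v _ h1 u hu h2 t ht h3
    exact h1 t (F.trans _ _ _ hu ht) h3 t (F.refl _) (h2 t ht h3)
  | andE1 φ ψ => intro w v _ h1; exact h1.1
  | andE2 φ ψ => intro w v _ h1; exact h1.2
  | andI φ ψ => intro w v _ h1 u hu h2; exact ⟨P _ _ _ hu h1, h2⟩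
  | orI1 φ ψ => intro w v _ h1; exact Or.inl h1
  | orI2 φ ψ => intro w v _ h1; exact Or.inr h1
  | orE φ ψ χ =>
    intro w v _ h1 u hu h2 t ht h3
    rcases h3 with h3 | h3
    · exact h1 t (F.trans _ _ _ hu ht) h3
    · exact h2 t ht h3
  | botE φ => intro w v _ h1; exact h1.elim
  | topI => intro w; trivial
  | mp φ ψ _ _ ih1 ih2 => intro w; exact ih1 w w (F.refl w) (ih2 w)

theorem s13_force_subst (F : Frame) (V : ℕ → F.W → Prop) (σ : ℕ → Form) (φ : Form) :
    ∀ w, F.force V (φ.subst σ) w ↔ F.force (fun p w => F.force V (σ p) w) φ w := by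
  induction φ with
  | var p => intro w; exact Iff.rfl
  | bot => intro w; exact Iff.rfl
  | top => intro w; exact Iff.rfl
  | and φ ψ ih1 ih2 => intro w; exact and_congr (ih1 w) (ih2 w)
  | or φ ψ ih1 ih2 => intro w; exact or_congr (ih1 w) (ih2 w)
  | imp φ ψ ih1 ih2 =>
    intro w
    exact forall_congr' fun v => imp_congr Iff.rfl (imp_congr (ih1 v) (ih2 v))

theorem s13_logK (K : Set Frame) : IsSILogic (LogK K) := by
  refine ⟨fun φ h F _ => s13_sound F φ h, ?_, ?_⟩
  · intro φ ψ h1 h2 F hF V hV w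
    exact h1 F hF V hV w w (F.refl w) (h2 F hF V hV w)
  · intro φ σ h F hF V hV w
    rw [s13_force_subst]
    exact h F hF _ (fun p a b hab => s13_persist F V hV (σ p) a b hab) w

theorem s13_force_pm (P Q : Frame) (f : P.W → Q.W) (hf : IsPMorphism P Q f)
    (V : ℕ → Q.W → Prop) (φ : Form) :
    ∀ a, P.force (fun p a => V p (f a)) φ a ↔ Q.force V φ (f a) := by
  induction φ with
  | var p => intro w; exact Iff.rfl
  | bot => intro w; exact Iff.rfl
  | top => intro w; exact Iff.rfl
  | and φ ψ ih1 ih2 => intro w; exact and_congr (ih1 w) (ih2 w)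
  | or φ ψ ih1 ih2 => intro w; exact or_congr (ih1 w) (ih2 w)
  | imp φ ψ ih1 ih2 =>
    intro w
    constructor
    · intro h v hv h1
      obtain ⟨a', ha, rfl⟩ := hf.2 w v hv
      exact (ih2 a').1 (h a' ha ((ih1 a').2 h1))
    · intro h v hv h1
      exact (ih2 v).2 (h _ (hf.1 _ _ hv) ((ih1 v).1 h1))

theorem s13_valid_image (P Q : Frame) (h : PMorphicImage P Q) (φ : Form) (hP : P.Valid φ) :
    Q.Valid φ := by
  obtain ⟨f, hf, hs⟩ := h
  intro V hV w
  obtain ⟨a, rfl⟩ := hs w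
  exact (s13_force_pm P Q f hf V φ a).1
    (hP _ (fun p a b hab => hV p _ _ (hf.1 _ _ hab)) a)

theorem s13_valid_up (F : Frame) (z : F.W) (φ : Form) (hF : F.Valid φ) : (F.up z).Valid φ := by
  intro V hV w
  have hpm : IsPMorphism (F.up z) F (fun a => a.1) := by
    refine ⟨fun a b h => h, fun a b h => ⟨⟨b, F.trans _ _ _ a.2 h⟩, h, rfl⟩⟩
  have key := s13_force_pm (F.up z) F _ hpm
    (fun p x => ∃ h : F.le z x, V p ⟨x, h⟩) φ w
  have hE : (fun (p : ℕ) (a : (F.up z).W) => ∃ h : F.le z a.1, V p ⟨a.1, h⟩) = V := by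
    funext p a
    exact propext ⟨fun ⟨_, h⟩ => h, fun h => ⟨a.2, h⟩⟩
  rw [hE] at key
  refine key.2 (hF _ ?_ _)
  rintro p a b hab ⟨h, hp⟩
  exact ⟨F.trans _ _ _ h hab, hV p ⟨a, h⟩ ⟨b, _⟩ hab hp⟩

theorem s13_yank_not (J : Form) (P Q : Frame) (hJ : IsYankov J Q) (hP : Finite P.W)
    (z : Q.W) (hz : ∀ w, Q.le z w) (h : PMorphicImage P Q) : ¬ P.Valid J := by
  refine (hJ P hP).2 ⟨Q, h, z, fun a => a.1, ⟨fun a b h => Subtype.ext h, fun w => ⟨⟨w, hz w⟩, rfl⟩⟩,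
    fun a b => Iff.rfl⟩

/-! ### Combs validate the Yankov formulas -/

theorem s13_comb_inc (n : ℕ) (J : Form) (Q : Frame) (hJ : IsYankov J Q) (a b a' b' : Q.W)
    (ha : Q.le a a') (ha' : a ≠ a') (hb : Q.le b b') (hb' : b ≠ b')
    (h1 : ¬ Q.le a b) (h2 : ¬ Q.le b a) : (Comb n).Valid J := by
  by_contra hv
  have hfin : Finite (Comb n).W := inferInstanceAs (Finite (Fin n ⊕ Fin n))
  obtain ⟨G, ⟨f, hf, hs⟩, z, e, he, hle⟩ := (hJ _ hfin).1 hv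
  have key : ∀ c c' : Q.W, Q.le c c' → c ≠ c' → ∃ g : (G.up z).W, e g = c ∧
      ∃ i : Fin n, f (Sum.inl i) = g.1 := by
    intro c c' hc hc'
    obtain ⟨g, rfl⟩ := he.2 c
    obtain ⟨g', rfl⟩ := he.2 c'
    refine ⟨g, rfl, ?_⟩
    obtain ⟨x, hx⟩ := hs g.1
    rcases x with i | i
    · exact ⟨i, hx⟩
    · exfalso
      have : G.le (f (Sum.inr i)) g'.1 := by rw [hx]; exact (hle _ _).2 hc
      obtain ⟨y, hy, hy'⟩ := hf.2 _ _ this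
      rcases y with j | j
      · exact hy
      · have hy : i = j := hy
        subst hy
        apply hc'
        congr 1
        exact Subtype.ext (hx.symm.trans hy')
  obtain ⟨ga, rfl, i, hi⟩ := key a a' ha ha'
  obtain ⟨gb, rfl, j, hj⟩ := key b b' hb hb'
  rcases le_total i j with hij | hij
  · apply h1
    rw [← hle]
    change G.le ga.1 gb.1
    rw [← hi, ← hj]
    exact hf.1 _ _ hij
  · apply h2
    rw [← hle]
    change G.le gb.1 ga.1
    rw [← hi, ← hj]
    exact hf.1 _ _ hij

theorem s13_comb_q8 (n : ℕ) (J : Form) (hJ : IsYankov J Q8f) : (Comb n).Valid J := by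
  by_contra hv
  have hfin : Finite (Comb n).W := inferInstanceAs (Finite (Fin n ⊕ Fin n))
  obtain ⟨G, ⟨f, hf, hs⟩, z, e, he, hle⟩ := (hJ _ hfin).1 hv
  obtain ⟨g0, h0⟩ := he.2 (0 : Fin 4)
  have hq : ∀ k : Fin 4, Q8f.le (0 : Fin 4) k := by
    change ∀ k : Fin 4, q8le 0 k = true
    decide
  have hq2 : ∀ k l : Fin 4, k ≠ 0 → Q8f.le k l → k = l := by
    change ∀ k l : Fin 4, k ≠ 0 → q8le k l = true → k = l
    decide
  -- successors of a preimage of the root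
  have hsucc : ∀ x : (Comb n).W, f x = g0.1 → ∀ k : Fin 4, ∃ y : (Comb n).W,
      (Comb n).le x y ∧ ∃ g : (G.up z).W, e g = k ∧ f y = g.1 := by
    intro x hx k
    obtain ⟨g, rfl⟩ := he.2 k
    have : G.le (f x) g.1 := by
      rw [hx]
      refine (hle g0 g).2 ?_
      rw [h0]
      exact hq _
    obtain ⟨y, hy, hy'⟩ := hf.2 _ _ this
    exact ⟨y, hy, g, rfl, hy'⟩
  have hne : ({i : Fin n | f (Sum.inl i) = g0.1} : Set (Fin n)).Nonempty := by
    obtain ⟨x, hx⟩ := hs g0.1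
    rcases x with i | i
    · exact ⟨i, hx⟩
    · exfalso
      obtain ⟨y, hy, g, hg, hg'⟩ := hsucc _ hx 1
      rcases y with j | j
      · exact hy
      · have hy : i = j := hy
        subst hy
        have : g0 = g := Subtype.ext (hx.symm.trans hg')
        rw [← this, h0] at hg
        exact absurd hg (by decide : ¬ (0 : Fin 4) = 1)
  obtain ⟨i, hi, hmax⟩ := Set.Finite.exists_maximal (Set.toFinite _) hne
  have hi : f (Sum.inl i) = g0.1 := hi
  have hmax' : ∀ j : Fin n, i < j → f (Sum.inl j) ≠ g0.1 := by
    intro j hj h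
    exact absurd (hmax (y := j) h hj.le) (not_le.2 hj)
  have hstep : ∀ k : Fin 4, k ≠ 0 → (∃ g : (G.up z).W, e g = k ∧ f (Sum.inr i) = g.1) ∨
      ∃ hlt : i.1 + 1 < n, ∃ g : (G.up z).W, e g = k ∧ G.le (f (Sum.inl ⟨i.1 + 1, hlt⟩)) g.1 := by
    intro k hk
    obtain ⟨y, hy, g, hg, hg'⟩ := hsucc _ hi k
    rcases y with j | j
    · have hy : i ≤ j := hy
      rcases hy.eq_or_lt with rfl | hy
      · exfalso
        have : g0 = g := Subtype.ext (hi.symm.trans hg')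
        rw [← this, h0] at hg
        exact hk hg.symm
      · right
        have hj := j.2
        have : i.1 < j.1 := hy
        refine ⟨by omega, g, hg, ?_⟩
        rw [← hg']
        refine hf.1 _ _ ?_
        change (⟨i.1 + 1, _⟩ : Fin n) ≤ j
        exact this
    · have hy : i ≤ j := hy
      rcases hy.eq_or_lt with rfl | hy
      · left; exact ⟨g, hg, hg'⟩
      · right
        have hj := j.2
        have : i.1 < j.1 := hy
        refine ⟨by omega, g, hg, ?_⟩
        rw [← hg']
        refine hf.1 _ _ ?_
        change (⟨i.1 + 1, _⟩ : Fin n) ≤ j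
        exact this
  have hA : ∀ k l : Fin 4, (∃ g : (G.up z).W, e g = k ∧ f (Sum.inr i) = g.1) →
      (∃ g : (G.up z).W, e g = l ∧ f (Sum.inr i) = g.1) → k = l := by
    rintro k l ⟨g, rfl, hg⟩ ⟨g', rfl, hg'⟩
    rw [Subtype.ext (hg.symm.trans hg')]
  have hB : ∀ k l : Fin 4,
      (∃ hlt : i.1 + 1 < n, ∃ g : (G.up z).W, e g = k ∧ G.le (f (Sum.inl ⟨i.1 + 1, hlt⟩)) g.1) →
      (∃ hlt : i.1 + 1 < n, ∃ g : (G.up z).W, e g = l ∧ G.le (f (Sum.inl ⟨i.1 + 1, hlt⟩)) g.1) →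
      k = l := by
    rintro k l ⟨hlt, g, rfl, hg⟩ ⟨_, g', rfl, hg'⟩
    have hlt' : i < ⟨i.1 + 1, hlt⟩ := by
      change i.1 < i.1 + 1
      omega
    have hzc : G.le z (f (Sum.inl ⟨i.1 + 1, hlt⟩)) := by
      refine G.trans _ _ _ g0.2 ?_
      rw [← hi]
      exact hf.1 _ _ hlt'.le
    have hc0 : e ⟨_, hzc⟩ ≠ (0 : Fin 4) := by
      intro h
      have := he.1 (h.trans h0.symm)
      exact hmax' _ hlt' (congrArg Subtype.val this)
    have e1 := hq2 _ _ hc0 ((hle ⟨_, hzc⟩ g).1 hg)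
    have e2 := hq2 _ _ hc0 ((hle ⟨_, hzc⟩ g').1 hg')
    exact e1.symm.trans e2
  have n12 : (1 : Fin 4) ≠ 2 := by decide
  have n13 : (1 : Fin 4) ≠ 3 := by decide
  have n23 : (2 : Fin 4) ≠ 3 := by decide
  rcases hstep 1 (by decide) with a1 | a1 <;> rcases hstep 2 (by decide) with a2 | a2 <;>
    rcases hstep 3 (by decide) with a3 | a3
  · exact n12 (hA _ _ a1 a2)
  · exact n12 (hA _ _ a1 a2)
  · exact n13 (hA _ _ a1 a3)
  · exact n23 (hB _ _ a2 a3)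
  · exact n23 (hA _ _ a2 a3)
  · exact n13 (hB _ _ a1 a3)
  · exact n12 (hB _ _ a1 a2)
  · exact n12 (hB _ _ a1 a2)

/-! ### Broken combs -/

theorem s13_broken_image (F : Frame) (m : ℕ) (h : IsBrokenComb F m) :
    PMorphicImage (Comb m) F := by
  classical
  obtain ⟨s, hs, e, he, hle⟩ := h
  -- a section of e
  obtain ⟨d, hd⟩ : ∃ d : ((Comb m).restrict s).W → F.W, ∀ x, e (d x) = x :=
    ⟨fun x => (he.2 x).choose, fun x => (he.2 x).choose_spec⟩
  have hdle : ∀ x y, F.le (d x) (d y) ↔ ((Comb m).restrict s).le x y := by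
    intro x y; rw [hle, hd, hd]
  have hde : ∀ a, d (e a) = a := fun a => he.1 (hd _)
  suffices PMorphicImage (Comb m) ((Comb m).restrict s) by
    obtain ⟨f, hf, hfs⟩ := this
    refine ⟨fun x => d (f x), ⟨fun a b h => (hdle _ _).2 (hf.1 _ _ h), ?_⟩, ?_⟩
    · intro a b h
      have : ((Comb m).restrict s).le (f a) (e b) := by
        rw [← hd (f a)]; exact (hle _ _).1 h
      obtain ⟨a', h1, h2⟩ := hf.2 _ _ this
      exact ⟨a', h1, by change d (f a') = b; rw [h2, hde]⟩
    · intro b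
      obtain ⟨a, ha⟩ := hfs (e b)
      exact ⟨a, by change d (f a) = b; rw [ha, hde]⟩
  cases m with
  | zero =>
    refine ⟨fun x => ?_, ⟨?_, ?_⟩, ?_⟩
    · rcases x with x | x <;> exact x.elim0
    · intro x; rcases x with x | x <;> exact x.elim0
    · intro x; rcases x with x | x <;> exact x.elim0
    · intro x; rcases x with ⟨x | x, _⟩ <;> exact x.elim0
  | succ k =>
    obtain ⟨t, ht1, ht2⟩ : ∃ t : ((Comb (k+1)).restrict s).W,
        (∀ i, (Comb (k+1)).le (Sum.inl i) t.1) ∧ (∀ b : ((Comb (k+1)).restrict s).W,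
          (Comb (k+1)).le t.1 b.1 → t = b) := by
      by_cases h : (Sum.inr (Fin.last k)) ∈ s
      · refine ⟨⟨_, h⟩, fun i => Fin.le_last i, ?_⟩
        rintro ⟨b | b, hb⟩ hh
        · exact hh.elim
        · have hh : Fin.last k = b := hh
          subst hh; rfl
      · refine ⟨⟨_, hs (Fin.last k)⟩, fun i => Fin.le_last i, ?_⟩
        rintro ⟨b | b, hb⟩ hh
        · have hh : Fin.last k ≤ b := hh
          have := Fin.last_le_iff.1 hh
          subst this; rfl
        · have hh : Fin.last k ≤ b := hh
          have := Fin.last_le_iff.1 hh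
          subst this; exact (h hb).elim
    let f : (Comb (k+1)).W → ((Comb (k+1)).restrict s).W := fun x =>
      match x with
      | .inl i => ⟨.inl i, hs i⟩
      | .inr i => if h : Sum.inr i ∈ s then ⟨.inr i, h⟩ else t
    have fl : ∀ i, f (.inl i) = ⟨.inl i, hs i⟩ := fun i => rfl
    have fr : ∀ i (h : Sum.inr i ∈ s), f (.inr i) = ⟨.inr i, h⟩ := fun i h => dif_pos h
    have fr' : ∀ i (h : ¬ Sum.inr i ∈ s), f (.inr i) = t := fun i h => dif_neg h
    refine ⟨f, ⟨?_, ?_⟩, ?_⟩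
    · rintro (i | i) (j | j) h
      · exact h
      · by_cases hj : Sum.inr j ∈ s
        · rw [fr j hj]; exact h
        · rw [fr' j hj]; exact ht1 i
      · exact h.elim
      · have h : i = j := h
        subst h
        exact ((Comb (k+1)).restrict s).refl _
    · rintro (i | i) ⟨b | b, hb⟩ h
      · exact ⟨.inl b, h, rfl⟩
      · exact ⟨.inr b, h, fr b hb⟩
      · refine ⟨.inr i, (Comb (k+1)).refl _, ?_⟩
        by_cases hj : Sum.inr i ∈ s
        · rw [fr i hj] at h; exact h.elim
        · rw [fr' i hj] at h ⊢; exact ht2 _ h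
      · refine ⟨.inr i, (Comb (k+1)).refl _, ?_⟩
        by_cases hj : Sum.inr i ∈ s
        · rw [fr i hj] at h ⊢
          have h : i = b := h
          subst h; rfl
        · rw [fr' i hj] at h ⊢; exact ht2 _ h
    · rintro ⟨b | b, hb⟩
      · exact ⟨.inl b, rfl⟩
      · exact ⟨.inr b, fr b hb⟩

theorem s13_broken_of (F : Frame) (m : ℕ) (g : F.W → (Comb m).W)
    (hg : ∀ a b, F.le a b ↔ (Comb m).le (g a) (g b)) (hi : ∀ i, ∃ a, g a = Sum.inl i) :
    IsBrokenComb F m := by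
  refine ⟨Set.range g, hi, fun a => ⟨g a, a, rfl⟩, ⟨?_, ?_⟩, hg⟩
  · intro a b h
    have h : g a = g b := congrArg Subtype.val h
    refine F.antisymm _ _ ((hg _ _).2 ?_) ((hg _ _).2 ?_)
    · rw [h]; exact (Comb m).refl _
    · rw [h]; exact (Comb m).refl _
  · rintro ⟨_, a, rfl⟩
    exact ⟨a, rfl⟩

/-- Nonmaximal points are comparable when the diamond is excluded. -/
theorem s13_claimA (J6 : Form) (h6 : IsYankov J6 Q6f) (F : Frame) (hF : Finite F.W) (r : F.W)
    (hr : ∀ w, F.le r w) (hv : F.Valid J6) (a b a' b' : F.W) (ha : F.lt a a') (hb : F.lt b b') :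
    F.le a b ∨ F.le b a := by
  classical
  by_contra hcon
  push Not at hcon
  obtain ⟨hab, hba⟩ := hcon
  refine s13_yank_not J6 F Q6f h6 hF (0 : Fin 4) ?_ ?_ hv
  · change ∀ k : Fin 4, q6le 0 k = true
    decide
  let f : F.W → Q6f.W := fun x =>
    if F.le x a then (if F.le x b then (0 : Fin 4) else (1 : Fin 4))
    else (if F.le x b then (2 : Fin 4) else (3 : Fin 4))
  have f0 : ∀ x, F.le x a → F.le x b → f x = (0 : Fin 4) := fun x h1 h2 => by simp [f, h1, h2]; rfl
  have f1 : ∀ x, F.le x a → ¬ F.le x b → f x = (1 : Fin 4) := fun x h1 h2 => by simp [f, h1, h2]; rfl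
  have f2 : ∀ x, ¬ F.le x a → F.le x b → f x = (2 : Fin 4) := fun x h1 h2 => by simp [f, h1, h2]; rfl
  have f3 : ∀ x, ¬ F.le x a → ¬ F.le x b → f x = (3 : Fin 4) := fun x h1 h2 => by simp [f, h1, h2]; rfl
  have ea : f a = (1 : Fin 4) := f1 a (F.refl a) hab
  have eb : f b = (2 : Fin 4) := f2 b hba (F.refl b)
  have ea' : f a' = (3 : Fin 4) := by
    refine f3 _ (fun h => ha.2 (F.antisymm _ _ ha.1 h)) (fun h => hab (F.trans _ _ _ ha.1 h))
  have eb' : f b' = (3 : Fin 4) := by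
    refine f3 _ (fun h => hba (F.trans _ _ _ hb.1 h)) (fun h => hb.2 (F.antisymm _ _ hb.1 h))
  have er : f r = (0 : Fin 4) := f0 _ (hr _) (hr _)
  refine ⟨f, ⟨?_, ?_⟩, ?_⟩
  · intro x y hxy
    have t1 : F.le y a → F.le x a := F.trans _ _ _ hxy
    have t2 : F.le y b → F.le x b := F.trans _ _ _ hxy
    by_cases x1 : F.le x a <;> by_cases x2 : F.le x b <;>
      by_cases y1 : F.le y a <;> by_cases y2 : F.le y b <;>
      first
      | exact absurd (t1 y1) x1
      | exact absurd (t2 y2) x2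
      | (simp only [f, x1, x2, y1, y2, if_true, if_false]; change q6le _ _ = true; decide)
  · intro x k hk
    have hk : q6le (f x) k = true := hk
    by_cases x1 : F.le x a <;> by_cases x2 : F.le x b
    · have : ∀ k : Fin 4, k = 0 ∨ k = 1 ∨ k = 2 ∨ k = 3 := by decide
      rcases this k with rfl | rfl | rfl | rfl
      · exact ⟨x, F.refl x, f0 _ x1 x2⟩
      · exact ⟨a, x1, ea⟩
      · exact ⟨b, x2, eb⟩
      · exact ⟨a', F.trans _ _ _ x1 ha.1, ea'⟩
    · rw [f1 x x1 x2] at hk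
      have : ∀ k : Fin 4, q6le 1 k = true → k = 1 ∨ k = 3 := by decide
      rcases this k hk with rfl | rfl
      · exact ⟨x, F.refl x, f1 _ x1 x2⟩
      · exact ⟨a', F.trans _ _ _ x1 ha.1, ea'⟩
    · rw [f2 x x1 x2] at hk
      have : ∀ k : Fin 4, q6le 2 k = true → k = 2 ∨ k = 3 := by decide
      rcases this k hk with rfl | rfl
      · exact ⟨x, F.refl x, f2 _ x1 x2⟩
      · exact ⟨b', F.trans _ _ _ x2 hb.1, eb'⟩
    · rw [f3 x x1 x2] at hk
      have : ∀ k : Fin 4, q6le 3 k = true → k = 3 := by decide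
      rcases this k hk with rfl
      exact ⟨x, F.refl x, f3 _ x1 x2⟩
  · intro k
    have : ∀ k : Fin 4, k = 0 ∨ k = 1 ∨ k = 2 ∨ k = 3 := by decide
    rcases this k with rfl | rfl | rfl | rfl
    · exact ⟨r, er⟩
    · exact ⟨a, ea⟩
    · exact ⟨b, eb⟩
    · exact ⟨a', ea'⟩

/-- Only one extra tooth when the three-fork is excluded. -/
theorem s13_claimB (J8 : Form) (h8 : IsYankov J8 Q8f) (F : Frame) (hF : Finite F.W) (r : F.W)
    (hr : ∀ w, F.le r w) (hv : F.Valid J8) (c : F.W) (hc : c ≠ r)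
    (hnm : ∀ x y, x ≠ r → F.lt x y → F.le c x)
    (t t' : F.W) (ht : t ≠ r) (ht' : t' ≠ r) (htc : ¬ F.le c t) (htc' : ¬ F.le c t') : t = t' := by
  classical
  by_contra htt
  refine s13_yank_not J8 F Q8f h8 hF (0 : Fin 4) ?_ ?_ hv
  · change ∀ k : Fin 4, q8le 0 k = true
    decide
  have hmax : ∀ x y, x ≠ r → F.le x y → ¬ F.le c y → x = y := by
    intro x y hx hxy hcy
    by_contra hne
    exact hcy (F.trans _ _ _ (hnm x y hx ⟨hxy, hne⟩) hxy)
  have hmaxt : ∀ y, F.le t y → t = y := by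
    intro y hy
    by_contra hne
    exact htc (hnm t y ht ⟨hy, hne⟩)
  have hmaxt' : ∀ y, F.le t' y → t' = y := by
    intro y hy
    by_contra hne
    exact htc' (hnm t' y ht' ⟨hy, hne⟩)
  let f : F.W → Q8f.W := fun x =>
    if x = r then (0 : Fin 4) else if x = t then (1 : Fin 4) else if x = t' then (2 : Fin 4)
      else (3 : Fin 4)
  have er : f r = (0 : Fin 4) := by simp [f]; rfl
  have et : f t = (1 : Fin 4) := by simp [f, ht]; rfl
  have et' : f t' = (2 : Fin 4) := by simp [f, ht', Ne.symm htt]; rfl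
  have e3 : ∀ x, x ≠ r → x ≠ t → x ≠ t' → f x = (3 : Fin 4) := by
    intro x h1 h2 h3; simp [f, h1, h2, h3]; rfl
  have ec : f c = (3 : Fin 4) := by
    refine e3 c hc ?_ ?_
    · rintro rfl; exact htc (F.refl _)
    · rintro rfl; exact htc' (F.refl _)
  have hf : ∀ x, x ≠ r → ∀ y, F.le x y → f y = f x := by
    intro x hx y hxy
    have hy : y ≠ r := by
      rintro rfl; exact hx (F.antisymm _ _ hxy (hr _))
    by_cases x1 : x = t
    · rw [x1] at hxy ⊢; rw [← hmaxt y hxy]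
    by_cases x2 : x = t'
    · rw [x2] at hxy ⊢; rw [← hmaxt' y hxy]
    rw [e3 x hx x1 x2]
    refine e3 y hy ?_ ?_
    · rintro rfl; exact x1 (hmax _ _ hx hxy htc)
    · rintro rfl; exact x2 (hmax _ _ hx hxy htc')
  have hs : ∀ k : Q8f.W, ∃ x, f x = k := by
    intro k
    have : ∀ k : Fin 4, k = 0 ∨ k = 1 ∨ k = 2 ∨ k = 3 := by decide
    rcases this k with rfl | rfl | rfl | rfl
    · exact ⟨r, er⟩
    · exact ⟨t, et⟩
    · exact ⟨t', et'⟩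
    · exact ⟨c, ec⟩
  refine ⟨f, ⟨?_, ?_⟩, hs⟩
  · intro x y hxy
    by_cases hx : x = r
    · rw [hx, er]
      have : ∀ k : Fin 4, q8le 0 k = true := by decide
      exact this _
    · rw [hf x hx y hxy]; exact Q8f.refl _
  · intro x k hk
    by_cases hx : x = r
    · obtain ⟨y, hy⟩ := hs k
      exact ⟨y, hx ▸ hr y, hy⟩
    · refine ⟨x, F.refl x, ?_⟩
      have h0 : f x ≠ (0 : Fin 4) := by
        by_cases x1 : x = t
        · rw [x1, et]; exact (by decide : (1 : Fin 4) ≠ 0)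
        by_cases x2 : x = t'
        · rw [x2, et']; exact (by decide : (2 : Fin 4) ≠ 0)
        rw [e3 x hx x1 x2]; exact (by decide : (3 : Fin 4) ≠ 0)
      have : ∀ k l : Fin 4, k ≠ 0 → q8le k l = true → k = l := by decide
      exact this _ _ h0 hk

theorem s13_to_broken (J6 J8 : Form) (h6 : IsYankov J6 Q6f) (h8 : IsYankov J8 Q8f) (N : ℕ) :
    ∀ F : Frame, Finite F.W → Nat.card F.W ≤ N → F.Rooted → F.Valid J6 → F.Valid J8 →
      ∃ m, IsBrokenComb F m := by
  classical
  induction N with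
  | zero =>
    intro F hF hN ⟨r, _⟩ _ _
    have : Nonempty F.W := ⟨r⟩
    have := Nat.card_pos (α := F.W)
    omega
  | succ N ih =>
    intro F hF hN ⟨r, hr⟩ v6 v8
    by_cases hone : ∀ x, x = r
    · refine ⟨1, s13_broken_of F 1 (fun _ => Sum.inl 0) ?_ ?_⟩
      · intro a b
        rw [hone a, hone b]
        exact ⟨fun _ => (Comb 1).refl _, fun _ => F.refl _⟩
      · intro i
        exact ⟨r, by rw [Subsingleton.elim i 0]⟩
    · push Not at hone
      obtain ⟨c, hc, hnm⟩ : ∃ c, c ≠ r ∧ ∀ x y, x ≠ r → F.lt x y → F.le c x := by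
        by_cases hex : ∃ x y, x ≠ r ∧ F.lt x y
        · -- choose the nonmaximal point with largest up-set
          let S : Set F.W := {x | x ≠ r ∧ ∃ y, F.lt x y}
          have hS : S.Nonempty := by
            obtain ⟨x, y, h1, h2⟩ := hex
            exact ⟨x, h1, y, h2⟩
          obtain ⟨c, hcS, hcm⟩ := Set.exists_max_image S
            (fun x => Nat.card {w // F.le x w}) (Set.toFinite S) hS
          refine ⟨c, hcS.1, ?_⟩
          intro x y hx hxy
          obtain ⟨-, c', hc'⟩ := hcS
          rcases s13_claimA J6 h6 F hF r hr v6 c x c' y hc' hxy with h | h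
          · exact h
          · have hcard := hcm x ⟨hx, y, hxy⟩
            by_contra hcx
            have hlt : Nat.card {w // F.le c w} < Nat.card {w // F.le x w} := by
              have := Set.ncard_lt_ncard (s := {w | F.le c w}) (t := {w | F.le x w})
                ⟨fun w hw => F.trans _ _ _ h hw, fun hsub => hcx (hsub (F.refl x))⟩
                (Set.toFinite _)
              exact this
            exact absurd hcard (not_le.2 hlt)
        · push Not at hex
          obtain ⟨c, hc⟩ := hone
          exact ⟨c, hc, fun x y hx hxy => (hex x y hx hxy).elim⟩
      have huniq := s13_claimB J8 h8 F hF r hr v8 c hc hnm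
      have hcr : ¬ F.le c r := fun h => hc (F.antisymm _ _ h (hr c))
      have hcard : Nat.card (F.up c).W ≤ N := by
        have h1 : Nat.card {w // F.le c w} < Nat.card F.W := by
          have := Set.ncard_lt_ncard (s := {w | F.le c w}) (t := Set.univ)
            ⟨fun w _ => trivial, fun hsub => hcr (hsub (Set.mem_univ r))⟩ (Set.toFinite _)
          rw [Set.ncard_univ] at this
          exact this
        have h2 : Nat.card (F.up c).W = Nat.card {w // F.le c w} := rfl
        omega
      have hfu : Finite (F.up c).W := inferInstanceAs (Finite {w // F.le c w})
      obtain ⟨m, s, hs, e, he, hle⟩ := ih (F.up c) hfu hcard ⟨⟨c, F.refl c⟩, fun w => w.2⟩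
        (s13_valid_up F c _ v6) (s13_valid_up F c _ v8)
      let sh : (Comb m).W → (Comb (m+1)).W := fun x =>
        match x with
        | .inl i => .inl i.succ
        | .inr i => .inr i.succ
      have hsh : ∀ x y, (Comb m).le x y ↔ (Comb (m+1)).le (sh x) (sh y) := by
        rintro (i | i) (j | j)
        · exact Fin.succ_le_succ_iff.symm
        · exact Fin.succ_le_succ_iff.symm
        · exact Iff.rfl
        · exact Fin.succ_inj.symm
      let g : F.W → (Comb (m+1)).W := fun x =>
        if h : F.le c x then sh (e ⟨x, h⟩).1 else if x = r then .inl 0 else .inr 0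
      have gr : g r = .inl 0 := by simp [g, hcr]; rfl
      have gc : ∀ x (h : F.le c x), g x = sh (e ⟨x, h⟩).1 := fun x h => dif_pos h
      have gt : ∀ x, ¬ F.le c x → x ≠ r → g x = .inr 0 := by
        intro x h1 h2; simp [g, h1, h2]; rfl
      have bot : ∀ y, (Comb (m+1)).le (.inl 0) y := by
        rintro (j | j)
        · exact Fin.zero_le j
        · exact Fin.zero_le j
      have sh1 : ∀ x, ¬ (Comb (m+1)).le (sh x) (.inl 0) := by
        rintro (j | j) h
        · exact absurd (Fin.le_zero_iff.1 h) (Fin.succ_ne_zero j)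
        · exact h
      have sh2 : ∀ x, ¬ (Comb (m+1)).le (sh x) (.inr 0) := by
        rintro (j | j) h
        · exact absurd (Fin.le_zero_iff.1 h) (Fin.succ_ne_zero j)
        · exact absurd h (Fin.succ_ne_zero j)
      have sh3 : ∀ x, ¬ (Comb (m+1)).le (.inr 0) (sh x) := by
        rintro (j | j) h
        · exact h
        · exact absurd h.symm (Fin.succ_ne_zero j)
      refine ⟨m + 1, s13_broken_of F (m+1) g ?_ ?_⟩
      · intro a b
        by_cases ha : a = r
        · subst ha
          rw [gr]
          exact ⟨fun _ => bot _, fun _ => hr _⟩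
        by_cases hca : F.le c a
        · rw [gc a hca]
          by_cases hcb : F.le c b
          · rw [gc b hcb, ← hsh]
            exact hle ⟨a, hca⟩ ⟨b, hcb⟩
          · have hn : ¬ F.le a b := fun h => hcb (F.trans _ _ _ hca h)
            by_cases hb : b = r
            · rw [hb, gr]; rw [hb] at hn
              exact ⟨fun h => (hn h).elim, fun h => (sh1 _ h).elim⟩
            · rw [gt b hcb hb]
              exact ⟨fun h => (hn h).elim, fun h => (sh2 _ h).elim⟩
        · rw [gt a hca ha]
          have hmax : ∀ y, F.le a y → a = y := by
            intro y hy
            by_contra hne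
            exact hca (hnm a y ha ⟨hy, hne⟩)
          by_cases hb : b = r
          · rw [hb, gr]
            exact ⟨fun h => (ha (hmax _ h)).elim, fun h => h.elim⟩
          by_cases hcb : F.le c b
          · rw [gc b hcb]
            refine ⟨fun h => ?_, fun h => (sh3 _ h).elim⟩
            rw [hmax b h] at hca
            exact (hca hcb).elim
          · rw [gt b hcb hb]
            rw [huniq a b ha hb hca hcb]
            exact ⟨fun _ => (Comb (m+1)).refl _, fun _ => F.refl _⟩
      · intro i
        refine Fin.cases ⟨r, gr⟩ (fun j => ?_) i
        obtain ⟨a, ha⟩ := he.2 ⟨.inl j, hs j⟩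
        exact ⟨a.1, by rw [gc a.1 a.2]; change sh (e a).1 = _; rw [ha]⟩

/-! ### The canonical model -/

/-- `T` is an `L`-theory. -/
def S13Th (L T : Set Form) : Prop :=
  L ⊆ T ∧ ∀ φ ψ : Form, Form.imp φ ψ ∈ T → φ ∈ T → ψ ∈ T

/-- Prime `L`-theories. -/
def S13Pr (L : Set Form) : Type :=
  {T : Set Form // S13Th L T ∧ Form.bot ∉ T ∧ ∀ α β : Form, Form.or α β ∈ T → α ∈ T ∨ β ∈ T}

theorem s13_ext (L : Set Form) (hL : IsSILogic L) (T : Set Form) (hT : S13Th L T) (α : Form) :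
    S13Th L {ψ | Form.imp α ψ ∈ T} ∧ T ⊆ {ψ | Form.imp α ψ ∈ T} ∧ α ∈ {ψ | Form.imp α ψ ∈ T} := by
  have ipc : ∀ φ, IPC φ → φ ∈ T := fun φ h => hT.1 (hL.1 h)
  have h1 : T ⊆ {ψ | Form.imp α ψ ∈ T} := fun ψ h => hT.2 _ _ (ipc _ (.ax1 ψ α)) h
  refine ⟨⟨fun ψ h => h1 (hT.1 h), ?_⟩, h1, ?_⟩
  · intro φ ψ h h'
    exact hT.2 _ _ (hT.2 _ _ (ipc _ (.ax2 α φ ψ)) h) h'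
  · exact ipc _ (.mp _ _ (.mp _ _ (.ax2 α (.imp α α) α) (.ax1 _ _)) (.ax1 _ _))

theorem s13_lind (L : Set Form) (hL : IsSILogic L) (T : Set Form) (hT : S13Th L T) (φ : Form)
    (hφ : φ ∉ T) : ∃ x : S13Pr L, T ⊆ x.1 ∧ φ ∉ x.1 := by
  obtain ⟨M, hTM, hM⟩ := zorn_subset_nonempty {U : Set Form | S13Th L U ∧ φ ∉ U} (by
    intro c hc hchain hne
    refine ⟨⋃₀ c, ⟨⟨?_, ?_⟩, ?_⟩, fun s hs => Set.subset_sUnion_of_mem hs⟩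
    · obtain ⟨U, hU⟩ := hne
      exact fun ψ h => ⟨U, hU, (hc hU).1.1 h⟩
    · rintro α β ⟨U, hU, h1⟩ ⟨U', hU', h2⟩
      rcases hchain.total hU hU' with h | h
      · exact ⟨U', hU', (hc hU').1.2 _ _ (h h1) h2⟩
      · exact ⟨U, hU, (hc hU).1.2 _ _ h1 (h h2)⟩
    · rintro ⟨U, hU, h⟩
      exact (hc hU).2 h) T ⟨hT, hφ⟩
  obtain ⟨hMT, hMφ⟩ := hM.prop
  have ipc : ∀ φ, IPC φ → φ ∈ M := fun φ h => hMT.1 (hL.1 h)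
  have key : ∀ α, α ∉ M → Form.imp α φ ∈ M := by
    intro α hα
    obtain ⟨e1, e2, e3⟩ := s13_ext L hL M hMT α
    by_contra hcon
    exact hα (hM.le_of_ge ⟨e1, hcon⟩ e2 e3)
  refine ⟨⟨M, hMT, ?_, ?_⟩, hTM, hMφ⟩
  · intro h
    exact hMφ (hMT.2 _ _ (ipc _ (.botE φ)) h)
  · intro α β h
    by_contra hcon
    push Not at hcon
    exact hMφ (hMT.2 _ _ (hMT.2 _ _ (hMT.2 _ _ (ipc _ (.orE α β φ)) (key α hcon.1))
      (key β hcon.2)) h)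

theorem s13_thL (L : Set Form) (hL : IsSILogic L) : S13Th L L := ⟨fun _ h => h, hL.2.1⟩

theorem s13_mem_ipc (L : Set Form) (hL : IsSILogic L) (x : S13Pr L) (φ : Form) (h : IPC φ) :
    φ ∈ x.1 := x.2.1.1 (hL.1 h)

theorem s13_mem_top (L : Set Form) (hL : IsSILogic L) (x : S13Pr L) : Form.top ∈ x.1 :=
  s13_mem_ipc L hL x _ .topI

theorem s13_mem_and (L : Set Form) (hL : IsSILogic L) (x : S13Pr L) (α β : Form) :
    Form.and α β ∈ x.1 ↔ α ∈ x.1 ∧ β ∈ x.1 := by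
  have ipc := s13_mem_ipc L hL x
  have mp := x.2.1.2
  exact ⟨fun h => ⟨mp _ _ (ipc _ (.andE1 α β)) h, mp _ _ (ipc _ (.andE2 α β)) h⟩,
    fun h => mp _ _ (mp _ _ (ipc _ (.andI α β)) h.1) h.2⟩

theorem s13_mem_or (L : Set Form) (hL : IsSILogic L) (x : S13Pr L) (α β : Form) :
    Form.or α β ∈ x.1 ↔ α ∈ x.1 ∨ β ∈ x.1 := by
  have ipc := s13_mem_ipc L hL x
  have mp := x.2.1.2
  exact ⟨x.2.2.2 α β, fun h => h.elim (mp _ _ (ipc _ (.orI1 α β))) (mp _ _ (ipc _ (.orI2 α β)))⟩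

theorem s13_mem_imp (L : Set Form) (hL : IsSILogic L) (x : S13Pr L) (α β : Form) :
    Form.imp α β ∈ x.1 ↔ ∀ y : S13Pr L, x.1 ⊆ y.1 → α ∈ y.1 → β ∈ y.1 := by
  constructor
  · intro h y hy ha
    exact y.2.1.2 _ _ (hy h) ha
  · intro h
    by_contra hcon
    obtain ⟨e1, e2, e3⟩ := s13_ext L hL x.1 x.2.1 α
    obtain ⟨y, hy, hy'⟩ := s13_lind L hL _ e1 β hcon
    exact hy' (h y (e2.trans hy) (hy e3))

theorem s13_complete (L : Set Form) (hL : IsSILogic L) (φ : Form) (h : ∀ x : S13Pr L, φ ∈ x.1) :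
    φ ∈ L := by
  by_contra hcon
  obtain ⟨x, _, hx⟩ := s13_lind L hL L (s13_thL L hL) φ hcon
  exact hx (h x)

/-- Finite disjunctions and conjunctions. -/
def s13Or (l : List Form) : Form := l.foldr Form.or Form.bot
def s13And (l : List Form) : Form := l.foldr Form.and Form.top

theorem s13_mem_bigOr (L : Set Form) (hL : IsSILogic L) (x : S13Pr L) (l : List Form) :
    s13Or l ∈ x.1 ↔ ∃ φ ∈ l, φ ∈ x.1 := by
  induction l with
  | nil => simp [s13Or, x.2.2.1]
  | cons a l ih =>
    have : s13Or (a :: l) = Form.or a (s13Or l) := rfl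
    rw [this, s13_mem_or L hL, ih]
    simp

theorem s13_mem_bigAnd (L : Set Form) (hL : IsSILogic L) (x : S13Pr L) (l : List Form) :
    s13And l ∈ x.1 ↔ ∀ φ ∈ l, φ ∈ x.1 := by
  induction l with
  | nil => simp [s13And, s13_mem_top L hL]
  | cons a l ih =>
    have : s13And (a :: l) = Form.and a (s13And l) := rfl
    rw [this, s13_mem_and L hL, ih]
    simp

theorem s13_vars_bigOr (m : ℕ) (l : List Form) (h : ∀ φ ∈ l, φ.varsLt m) : (s13Or l).varsLt m := by
  induction l with
  | nil => trivial
  | cons a l ih => exact ⟨h a (by simp), ih fun φ hφ => h φ (by simp [hφ])⟩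

theorem s13_vars_bigAnd (m : ℕ) (l : List Form) (h : ∀ φ ∈ l, φ.varsLt m) :
    (s13And l).varsLt m := by
  induction l with
  | nil => trivial
  | cons a l ih => exact ⟨h a (by simp), ih fun φ hφ => h φ (by simp [hφ])⟩

/-- Definable p-morphic images of rooted upsets of the canonical frame validate `L`. -/
theorem s13_definable (L : Set Form) (hL : IsSILogic L) (x : S13Pr L) (Q : Frame)
    (hQ : Finite Q.W) (f : S13Pr L → Q.W) (θ : Q.W → Form)
    (hθ : ∀ y : S13Pr L, x.1 ⊆ y.1 → ∀ q, θ q ∈ y.1 ↔ Q.le q (f y))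
    (hback : ∀ y : S13Pr L, x.1 ⊆ y.1 → ∀ q, Q.le (f y) q → ∃ y' : S13Pr L, y.1 ⊆ y'.1 ∧ f y' = q)
    (hs : ∀ q, ∃ y : S13Pr L, x.1 ⊆ y.1 ∧ f y = q) (φ : Form) (hφ : φ ∈ L) : Q.Valid φ := by
  classical
  intro V hV w
  have := Fintype.ofFinite Q.W
  let σ : ℕ → Form := fun p => s13Or ((Finset.univ.filter (fun q => V p q)).toList.map θ)
  have hσ : ∀ p (y : S13Pr L), x.1 ⊆ y.1 → (σ p ∈ y.1 ↔ V p (f y)) := by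
    intro p y hy
    rw [s13_mem_bigOr L hL]
    constructor
    · rintro ⟨ψ, h1, h2⟩
      simp only [List.mem_map, Finset.mem_toList, Finset.mem_filter, Finset.mem_univ,
        true_and] at h1
      obtain ⟨q, hq, rfl⟩ := h1
      exact hV p _ _ ((hθ y hy q).1 h2) hq
    · intro h
      refine ⟨θ (f y), ?_, (hθ y hy _).2 (Q.refl _)⟩
      simp only [List.mem_map, Finset.mem_toList, Finset.mem_filter, Finset.mem_univ, true_and]
      exact ⟨f y, h, rfl⟩
  have hmono : ∀ y y' : S13Pr L, x.1 ⊆ y.1 → y.1 ⊆ y'.1 → Q.le (f y) (f y') := by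
    intro y y' hy hyy
    exact (hθ y' (hy.trans hyy) _).1 (hyy ((hθ y hy _).2 (Q.refl _)))
  have key : ∀ ψ : Form, ∀ y : S13Pr L, x.1 ⊆ y.1 → (ψ.subst σ ∈ y.1 ↔ Q.force V ψ (f y)) := by
    intro ψ
    induction ψ with
    | var p => intro y hy; exact hσ p y hy
    | bot => intro y hy; exact ⟨fun h => y.2.2.1 h, fun h => h.elim⟩
    | top => intro y hy; exact ⟨fun _ => trivial, fun _ => s13_mem_top L hL y⟩
    | and α β ih1 ih2 =>
      intro y hy
      exact (s13_mem_and L hL y _ _).trans (and_congr (ih1 y hy) (ih2 y hy))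
    | or α β ih1 ih2 =>
      intro y hy
      exact (s13_mem_or L hL y _ _).trans (or_congr (ih1 y hy) (ih2 y hy))
    | imp α β ih1 ih2 =>
      intro y hy
      refine (s13_mem_imp L hL y _ _).trans ⟨?_, ?_⟩
      · intro h v hv hα
        obtain ⟨y', h1, rfl⟩ := hback y hy v hv
        exact (ih2 y' (hy.trans h1)).1 (h y' h1 ((ih1 y' (hy.trans h1)).2 hα))
      · intro h y' h1 hα
        exact (ih2 y' (hy.trans h1)).2 (h _ (hmono y y' hy h1) ((ih1 y' (hy.trans h1)).1 hα))
  obtain ⟨y, hy, rfl⟩ := hs w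
  exact (key φ y hy).1 (y.2.1.1 (hL.2.2 φ σ hφ))

/-- The formula stating that the first `m` variables are decided. -/
def s13Mu (m : ℕ) : Form :=
  s13And ((List.range m).map fun i => Form.or (.var i) (.imp (.var i) .bot))

def s13Col (L : Set Form) (m : ℕ) (x : S13Pr L) : Set (Fin m) := {i | Form.var i.1 ∈ x.1}

theorem s13_col_mono (L : Set Form) (m : ℕ) (x y : S13Pr L) (h : x.1 ⊆ y.1) :
    s13Col L m x ⊆ s13Col L m y := fun _ hi => h hi

theorem s13_mem_mu (L : Set Form) (hL : IsSILogic L) (m : ℕ) (x : S13Pr L) :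
    s13Mu m ∈ x.1 ↔ ∀ y : S13Pr L, x.1 ⊆ y.1 → s13Col L m y = s13Col L m x := by
  rw [s13Mu, s13_mem_bigAnd L hL]
  constructor
  · intro h y hy
    refine Set.Subset.antisymm ?_ (s13_col_mono L m x y hy)
    intro i hi
    have := h (Form.or (.var i.1) (.imp (.var i.1) .bot))
      (List.mem_map.2 ⟨i.1, List.mem_range.2 i.2, rfl⟩)
    rcases (s13_mem_or L hL x _ _).1 this with h1 | h1
    · exact h1
    · exact (y.2.2.1 ((s13_mem_imp L hL x _ _).1 h1 y hy hi)).elim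
  · intro h φ hφ
    obtain ⟨i, hi, rfl⟩ := List.mem_map.1 hφ
    rw [List.mem_range] at hi
    rw [s13_mem_or L hL]
    by_cases hx : Form.var i ∈ x.1
    · exact Or.inl hx
    · right
      rw [s13_mem_imp L hL]
      intro y hy hv
      have : (⟨i, hi⟩ : Fin m) ∈ s13Col L m y := hv
      rw [h y hy] at this
      exact (hx this).elim

theorem s13_sees_mu (L : Set Form) (hL : IsSILogic L) (m : ℕ) (x : S13Pr L) :
    ∃ y : S13Pr L, x.1 ⊆ y.1 ∧ s13Mu m ∈ y.1 := by
  obtain ⟨S, ⟨y, hy, rfl⟩, hS⟩ := Set.Finite.exists_maximal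
    (s := {S | ∃ y : S13Pr L, x.1 ⊆ y.1 ∧ s13Col L m y = S}) (Set.toFinite _)
    ⟨_, x, subset_rfl, rfl⟩
  refine ⟨y, hy, (s13_mem_mu L hL m y).2 fun z hz => ?_⟩
  exact Set.Subset.antisymm (hS ⟨z, hy.trans hz, rfl⟩ (s13_col_mono L m y z hz))
    (s13_col_mono L m y z hz)

/-- Points refuting `μ` above a common point are comparable. -/
theorem s13_chain (L : Set Form) (hL : IsSILogic L) (J6 : Form) (h6 : IsYankov J6 Q6f)
    (hJ : J6 ∈ L) (m : ℕ) (x d d' : S13Pr L) (hd : x.1 ⊆ d.1) (hd' : x.1 ⊆ d'.1)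
    (hm : s13Mu m ∉ d.1) (hm' : s13Mu m ∉ d'.1) : d.1 ⊆ d'.1 ∨ d'.1 ⊆ d.1 := by
  classical
  by_contra hcon
  push Not at hcon
  obtain ⟨hc1, hc2⟩ := hcon
  obtain ⟨α, hα, hα'⟩ := Set.not_subset.1 hc1
  obtain ⟨β, hβ, hβ'⟩ := Set.not_subset.1 hc2
  obtain ⟨A, hA⟩ : ∃ A, A = Form.or α (s13Mu m) := ⟨_, rfl⟩
  obtain ⟨B, hB⟩ : ∃ B, B = Form.or β (s13Mu m) := ⟨_, rfl⟩
  have mA : ∀ y : S13Pr L, A ∈ y.1 ↔ α ∈ y.1 ∨ s13Mu m ∈ y.1 := fun y => hA ▸ s13_mem_or L hL y _ _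
  have mB : ∀ y : S13Pr L, B ∈ y.1 ↔ β ∈ y.1 ∨ s13Mu m ∈ y.1 := fun y => hB ▸ s13_mem_or L hL y _ _
  obtain ⟨u, hu⟩ : ∃ u, u = Form.imp A B := ⟨_, rfl⟩
  obtain ⟨v, hv⟩ : ∃ v, v = Form.imp B A := ⟨_, rfl⟩
  have mu : ∀ y : S13Pr L, u ∈ y.1 ↔ ∀ z : S13Pr L, y.1 ⊆ z.1 → A ∈ z.1 → B ∈ z.1 :=
    fun y => hu ▸ s13_mem_imp L hL y _ _
  have mv : ∀ y : S13Pr L, v ∈ y.1 ↔ ∀ z : S13Pr L, y.1 ⊆ z.1 → B ∈ z.1 → A ∈ z.1 :=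
    fun y => hv ▸ s13_mem_imp L hL y _ _
  have hux : u ∉ x.1 := by
    intro h
    rcases (mB d).1 ((mu x).1 h d hd ((mA d).2 (Or.inl hα))) with h | h
    · exact hβ' h
    · exact hm h
  have hvx : v ∉ x.1 := by
    intro h
    rcases (mA d').1 ((mv x).1 h d' hd' ((mB d').2 (Or.inl hβ))) with h | h
    · exact hα' h
    · exact hm' h
  -- points refuting `v` see a `u`-point refuting `v`
  have see1 : ∀ y : S13Pr L, v ∉ y.1 → ∃ z : S13Pr L, y.1 ⊆ z.1 ∧ u ∈ z.1 ∧ v ∉ z.1 := by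
    intro y hy
    rw [mv] at hy
    push Not at hy
    obtain ⟨z, h1, h2, h3⟩ := hy
    exact ⟨z, h1, (mu z).2 fun w hw _ => hw h2, fun h => h3 ((mv z).1 h z subset_rfl h2)⟩
  have see2 : ∀ y : S13Pr L, u ∉ y.1 → ∃ z : S13Pr L, y.1 ⊆ z.1 ∧ u ∉ z.1 ∧ v ∈ z.1 := by
    intro y hy
    rw [mu] at hy
    push Not at hy
    obtain ⟨z, h1, h2, h3⟩ := hy
    exact ⟨z, h1, fun h => h3 ((mu z).1 h z subset_rfl h2), (mv z).2 fun w hw _ => hw h2⟩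
  have see3 : ∀ y : S13Pr L, ∃ z : S13Pr L, y.1 ⊆ z.1 ∧ u ∈ z.1 ∧ v ∈ z.1 := by
    intro y
    obtain ⟨z, hz, hz'⟩ := s13_sees_mu L hL m y
    exact ⟨z, hz, (mu z).2 fun w hw _ => (mB w).2 (Or.inr (hw hz')),
      (mv z).2 fun w hw _ => (mA w).2 (Or.inr (hw hz'))⟩
  have hQ : Finite Q6f.W := inferInstanceAs (Finite (Fin 4))
  have hnv : ¬ Q6f.Valid J6 := by
    refine s13_yank_not J6 Q6f Q6f h6 hQ (0 : Fin 4) ?_ ?_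
    · change ∀ k : Fin 4, q6le 0 k = true
      decide
    · exact ⟨id, ⟨fun a b h => h, fun a b h => ⟨b, h, rfl⟩⟩, Function.surjective_id⟩
  apply hnv
  let f : S13Pr L → Q6f.W := fun y =>
    if u ∈ y.1 then (if v ∈ y.1 then (3 : Fin 4) else (1 : Fin 4))
    else (if v ∈ y.1 then (2 : Fin 4) else (0 : Fin 4))
  have f0 : ∀ y : S13Pr L, u ∉ y.1 → v ∉ y.1 → f y = (0 : Fin 4) :=
    fun y h1 h2 => by simp [f, h1, h2]; rfl
  have f1 : ∀ y : S13Pr L, u ∈ y.1 → v ∉ y.1 → f y = (1 : Fin 4) :=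
    fun y h1 h2 => by simp [f, h1, h2]; rfl
  have f2 : ∀ y : S13Pr L, u ∉ y.1 → v ∈ y.1 → f y = (2 : Fin 4) :=
    fun y h1 h2 => by simp [f, h1, h2]; rfl
  have f3 : ∀ y : S13Pr L, u ∈ y.1 → v ∈ y.1 → f y = (3 : Fin 4) :=
    fun y h1 h2 => by simp [f, h1, h2]; rfl
  let θ : Fin 4 → Form := ![Form.top, u, v, Form.and u v]
  have four : ∀ k : Fin 4, k = 0 ∨ k = 1 ∨ k = 2 ∨ k = 3 := by decide
  have back : ∀ y : S13Pr L, ∀ q : Q6f.W, Q6f.le (f y) q → ∃ y' : S13Pr L, y.1 ⊆ y'.1 ∧ f y' = q := by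
    intro y k hk
    have hk : q6le (f y) k = true := hk
    obtain ⟨z3, a3, b3, c3⟩ := see3 y
    by_cases y1 : u ∈ y.1 <;> by_cases y2 : v ∈ y.1
    · rw [f3 y y1 y2] at hk
      have : ∀ k : Fin 4, q6le 3 k = true → k = 3 := by decide
      rcases this k hk with rfl
      exact ⟨y, subset_rfl, f3 _ y1 y2⟩
    · rw [f1 y y1 y2] at hk
      have : ∀ k : Fin 4, q6le 1 k = true → k = 1 ∨ k = 3 := by decide
      rcases this k hk with rfl | rfl
      · exact ⟨y, subset_rfl, f1 _ y1 y2⟩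
      · exact ⟨z3, a3, f3 _ b3 c3⟩
    · rw [f2 y y1 y2] at hk
      have : ∀ k : Fin 4, q6le 2 k = true → k = 2 ∨ k = 3 := by decide
      rcases this k hk with rfl | rfl
      · exact ⟨y, subset_rfl, f2 _ y1 y2⟩
      · exact ⟨z3, a3, f3 _ b3 c3⟩
    · obtain ⟨z1, a1, b1, c1⟩ := see1 y y2
      obtain ⟨z2, a2, b2, c2⟩ := see2 y y1
      rcases four k with rfl | rfl | rfl | rfl
      · exact ⟨y, subset_rfl, f0 _ y1 y2⟩
      · exact ⟨z1, a1, f1 _ b1 c1⟩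
      · exact ⟨z2, a2, f2 _ b2 c2⟩
      · exact ⟨z3, a3, f3 _ b3 c3⟩
  refine s13_definable L hL x Q6f hQ f θ ?_ (fun y _ => back y) ?_ J6 hJ
  · intro y hy k
    have hgoal : ∀ j l : Fin 4, f y = j → ((θ l ∈ y.1) ↔ q6le l j = true) →
        ((θ l ∈ y.1) ↔ Q6f.le l (f y)) := by
      intro j l h h'
      rw [h]; exact h'
    have t0 := s13_mem_top L hL y
    have t3 := s13_mem_and L hL y u v
    by_cases y1 : u ∈ y.1 <;> by_cases y2 : v ∈ y.1
    · refine hgoal 3 k (f3 y y1 y2) ?_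
      rcases four k with rfl | rfl | rfl | rfl <;> simp [θ, t0, t3, y1, y2, q6le]
    · refine hgoal 1 k (f1 y y1 y2) ?_
      rcases four k with rfl | rfl | rfl | rfl <;> simp [θ, t0, t3, y1, y2, q6le]
    · refine hgoal 2 k (f2 y y1 y2) ?_
      rcases four k with rfl | rfl | rfl | rfl <;> simp [θ, t0, t3, y1, y2, q6le]
    · refine hgoal 0 k (f0 y y1 y2) ?_
      rcases four k with rfl | rfl | rfl | rfl <;> simp [θ, t0, t3, y1, y2, q6le]
  · intro q
    refine back x q ?_
    rw [f0 x hux hvx]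
    have : ∀ k : Fin 4, q6le 0 k = true := by decide
    exact this q

/-! ### Local tabularity -/

def s13Val (L : Set Form) (m : ℕ) (x : S13Pr L) : Set (Fin m) × Set (Set (Fin m)) :=
  (s13Col L m x, {S | ∃ y : S13Pr L, x.1 ⊆ y.1 ∧ s13Mu m ∈ y.1 ∧ s13Col L m y = S})

def s13Ty (L : Set Form) (m : ℕ) (x : S13Pr L) : Set (Set (Fin m) × Set (Set (Fin m))) :=
  {p | ∃ y : S13Pr L, x.1 ⊆ y.1 ∧ s13Mu m ∉ y.1 ∧ s13Val L m y = p}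

def s13Kind (L : Set Form) (m : ℕ) (x : S13Pr L) :
    (Set (Fin m) × Set (Set (Fin m))) × Set (Set (Fin m) × Set (Set (Fin m))) :=
  (s13Val L m x, s13Ty L m x)

theorem s13_kind_mu (L : Set Form) (hL : IsSILogic L) (m : ℕ) (z z' : S13Pr L)
    (hz : s13Mu m ∈ z.1) (hz' : s13Mu m ∈ z'.1) (hc : s13Col L m z = s13Col L m z') :
    s13Kind L m z = s13Kind L m z' := by
  have hv : ∀ y : S13Pr L, s13Mu m ∈ y.1 → s13Kind L m y = ((s13Col L m y, {s13Col L m y}), ∅) := by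
    intro y hy
    have h1 : s13Ty L m y = ∅ := by
      ext p
      simp only [Set.mem_empty_iff_false, iff_false]
      rintro ⟨w, hw, hw', _⟩
      exact hw' (hw hy)
    have h2 : {S | ∃ w : S13Pr L, y.1 ⊆ w.1 ∧ s13Mu m ∈ w.1 ∧ s13Col L m w = S}
        = {s13Col L m y} := by
      ext S
      constructor
      · rintro ⟨w, hw, _, rfl⟩
        exact (s13_mem_mu L hL m y).1 hy w hw
      · rintro rfl
        exact ⟨y, subset_rfl, hy, rfl⟩
    rw [s13Kind, h1, s13Val, h2]
  rw [hv z hz, hv z' hz', hc]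

theorem s13_val_mono (L : Set Form) (m : ℕ) (x y : S13Pr L) (h : x.1 ⊆ y.1) :
    (s13Val L m x).1 ⊆ (s13Val L m y).1 ∧ (s13Val L m y).2 ⊆ (s13Val L m x).2 := by
  refine ⟨s13_col_mono L m x y h, ?_⟩
  rintro S ⟨w, hw, h1, h2⟩
  exact ⟨w, h.trans hw, h1, h2⟩

theorem s13_kind_d (L : Set Form) (hL : IsSILogic L) (J6 : Form) (h6 : IsYankov J6 Q6f)
    (hJ : J6 ∈ L) (m : ℕ) (y y' z z' : S13Pr L) (hy : y.1 ⊆ z.1) (hy' : y'.1 ⊆ z'.1)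
    (ht : s13Ty L m y = s13Ty L m y') (hz' : s13Mu m ∉ z'.1)
    (hv : s13Val L m z = s13Val L m z') : s13Ty L m z ⊆ s13Ty L m z' := by
  rintro p ⟨w, hw, hw1, rfl⟩
  have : s13Val L m w ∈ s13Ty L m y := ⟨w, hy.trans hw, hw1, rfl⟩
  rw [ht] at this
  obtain ⟨w', a, b, c⟩ := this
  rcases s13_chain L hL J6 h6 hJ m y' z' w' hy' a hz' b with h | h
  · exact ⟨w', h, b, c⟩
  · refine ⟨z', subset_rfl, hz', ?_⟩
    have m1 := s13_val_mono L m w' z' h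
    have m2 := s13_val_mono L m z w hw
    rw [c, ← hv] at m1
    rw [← hv]
    exact Prod.ext (Set.Subset.antisymm m2.1 m1.1) (Set.Subset.antisymm m1.2 m2.2)

theorem s13_kind_step (L : Set Form) (hL : IsSILogic L) (J6 : Form) (h6 : IsYankov J6 Q6f)
    (hJ : J6 ∈ L) (m : ℕ) (y y' z : S13Pr L) (hk : s13Kind L m y = s13Kind L m y')
    (hy : y.1 ⊆ z.1) : ∃ z' : S13Pr L, y'.1 ⊆ z'.1 ∧ s13Kind L m z = s13Kind L m z' := by
  have hk1 : s13Val L m y = s13Val L m y' := congrArg Prod.fst hk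
  have hk2 : s13Ty L m y = s13Ty L m y' := congrArg Prod.snd hk
  by_cases hz : s13Mu m ∈ z.1
  · have : s13Col L m z ∈ (s13Val L m y).2 := ⟨z, hy, hz, rfl⟩
    rw [hk1] at this
    obtain ⟨z', a, b, c⟩ := this
    exact ⟨z', a, s13_kind_mu L hL m z z' hz b c.symm⟩
  · have : s13Val L m z ∈ s13Ty L m y := ⟨z, hy, hz, rfl⟩
    rw [hk2] at this
    obtain ⟨z', a, b, c⟩ := this
    refine ⟨z', a, Prod.ext c.symm (Set.Subset.antisymm ?_ ?_)⟩
    · exact s13_kind_d L hL J6 h6 hJ m y y' z z' hy a hk2 b c.symm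
    · exact s13_kind_d L hL J6 h6 hJ m y' y z' z a hy hk2.symm hz c

theorem s13_kind_mem (L : Set Form) (hL : IsSILogic L) (J6 : Form) (h6 : IsYankov J6 Q6f)
    (hJ : J6 ∈ L) (m : ℕ) (φ : Form) : φ.varsLt m → ∀ y y' : S13Pr L,
    s13Kind L m y = s13Kind L m y' → φ ∈ y.1 → φ ∈ y'.1 := by
  induction φ with
  | var p =>
    intro hp y y' hk h
    have hc : s13Col L m y = s13Col L m y' := congrArg (fun k => k.1.1) hk
    have : (⟨p, hp⟩ : Fin m) ∈ s13Col L m y := h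
    rw [hc] at this
    exact this
  | bot => intro _ y y' _ h; exact (y.2.2.1 h).elim
  | top => intro _ y y' _ _; exact s13_mem_top L hL y'
  | and α β ih1 ih2 =>
    intro hp y y' hk h
    rw [s13_mem_and L hL] at h ⊢
    exact ⟨ih1 hp.1 y y' hk h.1, ih2 hp.2 y y' hk h.2⟩
  | or α β ih1 ih2 =>
    intro hp y y' hk h
    rw [s13_mem_or L hL] at h ⊢
    exact h.imp (ih1 hp.1 y y' hk) (ih2 hp.2 y y' hk)
  | imp α β ih1 ih2 =>
    intro hp y y' hk h
    rw [s13_mem_imp L hL] at h ⊢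
    intro z' hz' hα
    obtain ⟨z, hz, hkz⟩ := s13_kind_step L hL J6 h6 hJ m y' y z' hk.symm hz'
    exact ih2 hp.2 z z' hkz.symm (h z hz (ih1 hp.1 z' z hkz hα))

theorem s13_loctab (L : Set Form) (hL : IsSILogic L) (J6 : Form) (h6 : IsYankov J6 Q6f)
    (hJ : J6 ∈ L) (m : ℕ) : ∃ Φ : Finset Form, (∀ ψ ∈ Φ, ψ.varsLt m) ∧
      ∀ φ : Form, φ.varsLt m → ∃ ψ ∈ Φ, ∀ y : S13Pr L, φ ∈ y.1 ↔ ψ ∈ y.1 := by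
  classical
  let tr : {φ : Form // φ.varsLt m} →
      Set ((Set (Fin m) × Set (Set (Fin m))) × Set (Set (Fin m) × Set (Set (Fin m)))) :=
    fun φ => {k | ∃ y : S13Pr L, s13Kind L m y = k ∧ φ.1 ∈ y.1}
  have hfin : (Set.range tr).Finite := Set.toFinite _
  have hch : ∀ t : Set.range tr, ∃ φ, tr φ = t.1 := fun t => t.2
  choose g hg using hch
  have : Fintype (Set.range tr) := hfin.fintype
  refine ⟨Finset.univ.image fun t => (g t).1, ?_, ?_⟩
  · intro ψ hψ
    obtain ⟨t, _, rfl⟩ := Finset.mem_image.1 hψ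
    exact (g t).2
  · intro φ hφ
    have e := hg ⟨tr ⟨φ, hφ⟩, _, rfl⟩
    refine ⟨_, Finset.mem_image.2 ⟨⟨tr ⟨φ, hφ⟩, _, rfl⟩, Finset.mem_univ _, rfl⟩, ?_⟩
    have key : ∀ (a b : {φ : Form // φ.varsLt m}), tr a = tr b → ∀ y : S13Pr L,
        a.1 ∈ y.1 → b.1 ∈ y.1 := by
      intro a b hab y hy
      have : s13Kind L m y ∈ tr a := ⟨y, rfl, hy⟩
      rw [hab] at this
      obtain ⟨y', hk, h⟩ := this
      exact s13_kind_mem L hL J6 h6 hJ m b.1 b.2 y' y hk h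
    intro y
    exact ⟨key ⟨φ, hφ⟩ _ e.symm y, key _ ⟨φ, hφ⟩ e y⟩

theorem s13_iff_mem (L : Set Form) (hL : IsSILogic L) (φ ψ : Form)
    (h : ∀ y : S13Pr L, φ ∈ y.1 ↔ ψ ∈ y.1) : Form.iff φ ψ ∈ L := by
  refine s13_complete L hL _ fun x => ?_
  rw [Form.iff, s13_mem_and L hL, s13_mem_imp L hL, s13_mem_imp L hL]
  exact ⟨fun y _ => (h y).1, fun y _ => (h y).2⟩

theorem s13_vars_mono (φ : Form) : ∀ m n : ℕ, m ≤ n → φ.varsLt m → φ.varsLt n := by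
  induction φ with
  | var p => intro m n h h'; exact lt_of_lt_of_le h' h
  | bot => intros; trivial
  | top => intros; trivial
  | and α β ih1 ih2 => intro m n h h'; exact ⟨ih1 m n h h'.1, ih2 m n h h'.2⟩
  | or α β ih1 ih2 => intro m n h h'; exact ⟨ih1 m n h h'.1, ih2 m n h h'.2⟩
  | imp α β ih1 ih2 => intro m n h h'; exact ⟨ih1 m n h h'.1, ih2 m n h h'.2⟩

theorem s13_vars_ex (φ : Form) : ∃ m, φ.varsLt m := by
  have bin : ∀ α β : Form, (∃ m, α.varsLt m) → (∃ m, β.varsLt m) →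
      ∃ m, α.varsLt m ∧ β.varsLt m := by
    rintro α β ⟨m, hm⟩ ⟨n, hn⟩
    exact ⟨max m n, s13_vars_mono α m _ (le_max_left _ _) hm,
      s13_vars_mono β n _ (le_max_right _ _) hn⟩
  induction φ with
  | var p => exact ⟨p + 1, Nat.lt_succ_self p⟩
  | bot => exact ⟨0, trivial⟩
  | top => exact ⟨0, trivial⟩
  | and α β ih1 ih2 => exact bin α β ih1 ih2
  | or α β ih1 ih2 => exact bin α β ih1 ih2
  | imp α β ih1 ih2 => exact bin α β ih1 ih2

/-! ### Finite model property -/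

/-- The finite quotient of `↑x` by the formulas in `Φ`. -/
def s13Quot (L : Set Form) (x : S13Pr L) (Φ : Finset Form) : Frame where
  W := {T : Set Φ // ∃ y : S13Pr L, x.1 ⊆ y.1 ∧ {ψ : Φ | ψ.1 ∈ y.1} = T}
  le a b := a.1 ⊆ b.1
  refl _ := subset_rfl
  trans _ _ _ h1 h2 := h1.trans h2
  antisymm _ _ h1 h2 := Subtype.ext (Set.Subset.antisymm h1 h2)

theorem s13_fmp (L : Set Form) (hL : IsSILogic L) (J6 : Form) (h6 : IsYankov J6 Q6f)
    (hJ : J6 ∈ L) (φ : Form) (hφ : φ ∉ L) :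
    ∃ Q : Frame, Finite Q.W ∧ Q.Rooted ∧ (∀ ψ ∈ L, Q.Valid ψ) ∧ ¬ Q.Valid φ := by
  classical
  obtain ⟨m, hm⟩ := s13_vars_ex φ
  obtain ⟨Φ, hΦ, hrep⟩ := s13_loctab L hL J6 h6 hJ m
  obtain ⟨x, _, hx⟩ := s13_lind L hL L (s13_thL L hL) φ hφ
  have hfin : Finite (s13Quot L x Φ).W :=
    inferInstanceAs (Finite {T : Set Φ // ∃ y : S13Pr L, x.1 ⊆ y.1 ∧ {ψ : Φ | ψ.1 ∈ y.1} = T})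
  let rt : (s13Quot L x Φ).W := ⟨{ψ : Φ | ψ.1 ∈ x.1}, x, subset_rfl, rfl⟩
  let f : S13Pr L → (s13Quot L x Φ).W := fun y =>
    if h : x.1 ⊆ y.1 then ⟨{ψ : Φ | ψ.1 ∈ y.1}, y, h, rfl⟩ else rt
  have hf : ∀ y : S13Pr L, ∀ h : x.1 ⊆ y.1, f y = ⟨{ψ : Φ | ψ.1 ∈ y.1}, y, h, rfl⟩ :=
    fun y h => dif_pos h
  let pos : Set Φ → Form := fun T => s13And ((Finset.univ.filter (fun ψ => ψ ∈ T)).toList.map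
    Subtype.val)
  let neg : Set Φ → Form := fun T => s13Or ((Finset.univ.filter (fun ψ => ψ ∉ T)).toList.map
    Subtype.val)
  have hpos : ∀ T (y : S13Pr L), pos T ∈ y.1 ↔ T ⊆ {ψ : Φ | ψ.1 ∈ y.1} := by
    intro T y
    rw [s13_mem_bigAnd L hL]
    constructor
    · intro h ψ hψ
      refine h ψ.1 (List.mem_map.2 ⟨ψ, ?_, rfl⟩)
      simpa using hψ
    · intro h α hα
      obtain ⟨ψ, hψ, rfl⟩ := List.mem_map.1 hα
      refine h ?_
      simpa using hψ
  have hneg : ∀ T (y : S13Pr L), neg T ∈ y.1 ↔ ¬ {ψ : Φ | ψ.1 ∈ y.1} ⊆ T := by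
    intro T y
    rw [s13_mem_bigOr L hL, Set.not_subset]
    constructor
    · rintro ⟨α, hα, h⟩
      obtain ⟨ψ, hψ, rfl⟩ := List.mem_map.1 hα
      refine ⟨ψ, h, ?_⟩
      simpa using hψ
    · rintro ⟨ψ, h, hψ⟩
      refine ⟨ψ.1, List.mem_map.2 ⟨ψ, ?_, rfl⟩, h⟩
      simpa using hψ
  have vpos : ∀ T, (pos T).varsLt m := by
    intro T
    refine s13_vars_bigAnd m _ fun α hα => ?_
    obtain ⟨ψ, hψ, rfl⟩ := List.mem_map.1 hα
    exact hΦ _ ψ.2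
  have vneg : ∀ T, (neg T).varsLt m := by
    intro T
    refine s13_vars_bigOr m _ fun α hα => ?_
    obtain ⟨ψ, hψ, rfl⟩ := List.mem_map.1 hα
    exact hΦ _ ψ.2
  have transfer : ∀ α : Form, α.varsLt m → ∀ y z : S13Pr L,
      {ψ : Φ | ψ.1 ∈ y.1} ⊆ {ψ : Φ | ψ.1 ∈ z.1} → α ∈ y.1 → α ∈ z.1 := by
    intro α hα y z hyz h
    obtain ⟨ψ, hψ, he⟩ := hrep α hα
    exact (he z).2 (@hyz ⟨ψ, hψ⟩ ((he y).1 h))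
  have hval : ∀ ψ ∈ L, (s13Quot L x Φ).Valid ψ := by
    refine s13_definable L hL x _ hfin f (fun q => pos q.1) ?_ ?_ ?_
    · intro y hy q
      rw [hf y hy]
      exact hpos _ _
    · rintro y hy ⟨T, z, hz, rfl⟩ hle
      rw [hf y hy] at hle
      have hle : {ψ : Φ | ψ.1 ∈ y.1} ⊆ {ψ : Φ | ψ.1 ∈ z.1} := hle
      have hn : Form.imp (pos {ψ : Φ | ψ.1 ∈ z.1}) (neg {ψ : Φ | ψ.1 ∈ z.1}) ∉ y.1 := by
        intro h
        have h' := transfer (Form.imp (pos {ψ : Φ | ψ.1 ∈ z.1}) (neg {ψ : Φ | ψ.1 ∈ z.1})) ⟨vpos _, vneg _⟩ y z hle h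
        exact (hneg _ z).1 (z.2.1.2 _ _ h' ((hpos _ z).2 subset_rfl)) subset_rfl
      rw [s13_mem_imp L hL] at hn
      push Not at hn
      obtain ⟨w, hw, h1, h2⟩ := hn
      refine ⟨w, hw, ?_⟩
      rw [hf w (hy.trans hw)]
      refine Subtype.ext (Set.Subset.antisymm ?_ ((hpos _ w).1 h1))
      by_contra hcon
      exact h2 ((hneg _ w).2 hcon)
    · rintro ⟨T, z, hz, rfl⟩
      exact ⟨z, hz, hf z hz⟩
  refine ⟨s13Quot L x Φ, hfin, ⟨rt, ?_⟩, hval, ?_⟩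
  · rintro ⟨T, z, hz, rfl⟩ ψ h
    exact hz h
  · -- the canonical valuation refutes `φ`
    intro hv
    let V : ℕ → (s13Quot L x Φ).W → Prop := fun p q =>
      ∃ y : S13Pr L, x.1 ⊆ y.1 ∧ f y = q ∧ p < m ∧ Form.var p ∈ y.1
    have hsub : ∀ y z : S13Pr L, x.1 ⊆ y.1 → x.1 ⊆ z.1 → (s13Quot L x Φ).le (f y) (f z) →
        {ψ : Φ | ψ.1 ∈ y.1} ⊆ {ψ : Φ | ψ.1 ∈ z.1} := by
      intro y z hy hz h
      rw [hf y hy, hf z hz] at h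
      exact h
    have hV : (s13Quot L x Φ).Persistent V := by
      rintro p a ⟨T, z, hz, rfl⟩ hab ⟨y, hy, rfl, hp, h⟩
      rw [← hf z hz] at hab ⊢
      exact ⟨z, hz, rfl, hp, transfer (.var p) hp y z (hsub y z hy hz hab) h⟩
    have key : ∀ ψ : Form, ψ.varsLt m → ∀ y : S13Pr L, x.1 ⊆ y.1 →
        ((s13Quot L x Φ).force V ψ (f y) ↔ ψ ∈ y.1) := by
      intro ψ
      induction ψ with
      | var p =>
        intro hp y hy
        constructor
        · rintro ⟨z, hz, he, _, h⟩
          refine transfer (.var p) hp z y (hsub z y hz hy ?_) h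
          rw [he]; exact (s13Quot L x Φ).refl _
        · intro h
          exact ⟨y, hy, rfl, hp, h⟩
      | bot => intro _ y _; exact ⟨fun h => h.elim, fun h => y.2.2.1 h⟩
      | top => intro _ y _; exact ⟨fun _ => s13_mem_top L hL y, fun _ => trivial⟩
      | and α β ih1 ih2 =>
        intro hp y hy
        exact (and_congr (ih1 hp.1 y hy) (ih2 hp.2 y hy)).trans (s13_mem_and L hL y _ _).symm
      | or α β ih1 ih2 =>
        intro hp y hy
        exact (or_congr (ih1 hp.1 y hy) (ih2 hp.2 y hy)).trans (s13_mem_or L hL y _ _).symm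
      | imp α β ih1 ih2 =>
        intro hp y hy
        constructor
        · intro h
          rw [s13_mem_imp L hL]
          intro z hz hα
          have hxz := hy.trans hz
          refine (ih2 hp.2 z hxz).1 (h (f z) ?_ ((ih1 hp.1 z hxz).2 hα))
          rw [hf y hy, hf z hxz]
          exact fun ψ hψ => hz hψ
        · rintro h ⟨T, z, hz, rfl⟩ hle hα
          rw [← hf z hz] at hle hα ⊢
          have h' := transfer _ hp y z (hsub y z hy hz hle) h
          exact (ih2 hp.2 z hz).2 (z.2.1.2 _ _ h' ((ih1 hp.1 z hz).1 hα))
    exact hx ((key φ hm x subset_rfl).1 (hv V hV _))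

theorem s13_oplus (L Γ : Set Form) : IsSILogic (oplus L Γ) := by
  refine ⟨fun φ h M hM => hM.1.1 h, ?_, ?_⟩
  · intro φ ψ h1 h2 M hM
    exact hM.1.2.1 φ ψ (h1 M hM) (h2 M hM)
  · intro φ σ h M hM
    exact hM.1.2.2 φ σ (h M hM)

theorem s13_comb_all (J2 J4 J5 J6 J7 J8 : Form)
    (h2 : IsYankov J2 Q2f) (h4 : IsYankov J4 Q4f) (h5 : IsYankov J5 Q5f)
    (h6 : IsYankov J6 Q6f) (h7 : IsYankov J7 Q7f) (h8 : IsYankov J8 Q8f) (n : ℕ) :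
    ∀ J ∈ ({J2, J4, J5, J6, J7, J8} : Set Form), (Comb n).Valid J := by
  have d2 : q2le 1 3 = true ∧ (1 : Fin 5) ≠ 3 ∧ q2le 2 4 = true ∧ (2 : Fin 5) ≠ 4 ∧
    ¬ q2le 1 2 = true ∧ ¬ q2le 2 1 = true := by decide
  have d4 : q4le 1 3 = true ∧ (1 : Fin 5) ≠ 3 ∧ q4le 2 4 = true ∧ (2 : Fin 5) ≠ 4 ∧
    ¬ q4le 1 2 = true ∧ ¬ q4le 2 1 = true := by decide
  have d5 : q5le 1 3 = true ∧ (1 : Fin 6) ≠ 3 ∧ q5le 2 4 = true ∧ (2 : Fin 6) ≠ 4 ∧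
    ¬ q5le 1 2 = true ∧ ¬ q5le 2 1 = true := by decide
  have d6 : q6le 1 3 = true ∧ (1 : Fin 4) ≠ 3 ∧ q6le 2 3 = true ∧ (2 : Fin 4) ≠ 3 ∧
    ¬ q6le 1 2 = true ∧ ¬ q6le 2 1 = true := by decide
  have d7 : q7le 1 3 = true ∧ (1 : Fin 5) ≠ 3 ∧ q7le 2 4 = true ∧ (2 : Fin 5) ≠ 4 ∧
    ¬ q7le 1 2 = true ∧ ¬ q7le 2 1 = true := by decide
  rintro J (rfl | rfl | rfl | rfl | rfl | rfl)
  · exact s13_comb_inc n _ Q2f h2 (1 : Fin 5) (2 : Fin 5) (3 : Fin 5) (4 : Fin 5)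
      d2.1 d2.2.1 d2.2.2.1 d2.2.2.2.1 d2.2.2.2.2.1 d2.2.2.2.2.2
  · exact s13_comb_inc n _ Q4f h4 (1 : Fin 5) (2 : Fin 5) (3 : Fin 5) (4 : Fin 5)
      d4.1 d4.2.1 d4.2.2.1 d4.2.2.2.1 d4.2.2.2.2.1 d4.2.2.2.2.2
  · exact s13_comb_inc n _ Q5f h5 (1 : Fin 6) (2 : Fin 6) (3 : Fin 6) (4 : Fin 6)
      d5.1 d5.2.1 d5.2.2.1 d5.2.2.2.1 d5.2.2.2.2.1 d5.2.2.2.2.2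
  · exact s13_comb_inc n _ Q6f h6 (1 : Fin 4) (2 : Fin 4) (3 : Fin 4) (3 : Fin 4)
      d6.1 d6.2.1 d6.2.2.1 d6.2.2.2.1 d6.2.2.2.2.1 d6.2.2.2.2.2
  · exact s13_comb_inc n _ Q7f h7 (1 : Fin 5) (2 : Fin 5) (3 : Fin 5) (4 : Fin 5)
      d7.1 d7.2.1 d7.2.2.1 d7.2.2.2.1 d7.2.2.2.2.1 d7.2.2.2.2.2
  · exact s13_comb_q8 n _ h8

/-- The logic `IPC ⊕ {𝒥(Q_i) : i ∈ {2,4,5,6,7,8}}` is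
locally tabular, its finite rooted frames are exactly the broken combs, and it
coincides with the logic `LFC` of all finite combs. -/
theorem statement13 (J2 J4 J5 J6 J7 J8 : Form)
    (h2 : IsYankov J2 Q2f) (h4 : IsYankov J4 Q4f) (h5 : IsYankov J5 Q5f)
    (h6 : IsYankov J6 Q6f) (h7 : IsYankov J7 Q7f) (h8 : IsYankov J8 Q8f) :
    LocallyTabular (oplus IPCSet {J2, J4, J5, J6, J7, J8}) ∧
    (∀ F : Frame, Finite F.W → F.Rooted →
      ((∀ φ ∈ oplus IPCSet {J2, J4, J5, J6, J7, J8}, F.Valid φ) ↔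
        ∃ m, IsBrokenComb F m)) ∧
    oplus IPCSet {J2, J4, J5, J6, J7, J8} = LFC := by
  have hL := s13_oplus IPCSet {J2, J4, J5, J6, J7, J8}
  have hJ : ∀ J ∈ ({J2, J4, J5, J6, J7, J8} : Set Form),
      J ∈ oplus IPCSet {J2, J4, J5, J6, J7, J8} := fun J hJ M hM => hM.2.2 hJ
  have hJ6 := hJ J6 (by simp)
  have hJ8 := hJ J8 (by simp)
  have hsub : oplus IPCSet {J2, J4, J5, J6, J7, J8} ⊆ LFC := by
    intro φ hφ
    refine hφ LFC ⟨s13_logK _, (s13_logK _).1, ?_⟩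
    rintro J hJ _ ⟨n, rfl⟩
    exact s13_comb_all J2 J4 J5 J6 J7 J8 h2 h4 h5 h6 h7 h8 n J hJ
  have hbr : ∀ F : Frame, Finite F.W → F.Rooted →
      (∀ φ ∈ oplus IPCSet {J2, J4, J5, J6, J7, J8}, F.Valid φ) → ∃ m, IsBrokenComb F m :=
    fun F hF hr hv => s13_to_broken J6 J8 h6 h8 _ F hF le_rfl hr (hv _ hJ6) (hv _ hJ8)
  have hbr' : ∀ (F : Frame) (m : ℕ), IsBrokenComb F m → ∀ φ ∈ LFC, F.Valid φ :=
    fun F m h φ hφ => s13_valid_image (Comb m) F (s13_broken_image F m h) φ (hφ _ ⟨m, rfl⟩)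
  refine ⟨?_, ?_, ?_⟩
  · intro m
    obtain ⟨Φ, _, h⟩ := s13_loctab _ hL J6 h6 hJ6 m
    refine ⟨Φ, fun φ hφ => ?_⟩
    obtain ⟨ψ, hψ, he⟩ := h φ hφ
    exact ⟨ψ, hψ, s13_iff_mem _ hL φ ψ he⟩
  · intro F hF hr
    refine ⟨hbr F hF hr, ?_⟩
    rintro ⟨m, hm⟩ φ hφ
    exact hbr' F m hm φ (hsub hφ)
  · refine Set.Subset.antisymm hsub ?_
    intro φ hφ
    by_contra hcon
    obtain ⟨Q, q1, q2, q3, q4⟩ := s13_fmp _ hL J6 h6 hJ6 φ hcon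
    obtain ⟨m, hm⟩ := hbr Q q1 q2 q3
    exact q4 (hbr' Q m hm φ hφ)
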